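/- arXiv:2407.09368 — 12 statements merged into one kernel-verified Lean document; each statement's English description precedes it below -/
import Mathlib

section
/- Let (S_i)_{i∈I} be a finite indexed family of finite sets with |I| = ℓ ≥ 1. Then there exists a subset J ⊆ I such that H_ℓ · |Ũ(J)| ≥ |ψ(I)|; that is, some subfamily has unique coverage at least a 1/H_ℓ fraction of the whole family's coverage. -/
open Finset

/-- The cover of the subfamily indexed by `J`: ψ(J) = ⋃_{i ∈ J} S i. -/
def cov {α ι : Type*} [DecidableEq α] (S : ι → Finset α) (J : Finset ι) : Finset α :=
  J.biUnion S

/-- The unique cover of the subfamily indexed by `J`: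
Ũ(J) = {x : x ∈ S i for exactly one i ∈ J}. -/
def uniqCov {α ι : Type*} [DecidableEq α] [DecidableEq ι] (S : ι → Finset α) (J : Finset ι) :
    Finset α :=
  (J.biUnion S).filter fun x => (J.filter fun i => x ∈ S i).card = 1

/-- The non-unique cover of the subfamily indexed by `J`:
ψ_{≥2}(J) = {x : x ∈ S i for at least two i ∈ J}. -/
def nonUniqCov {α ι : Type*} [DecidableEq α] [DecidableEq ι] (S : ι → Finset α) (J : Finset ι) :
    Finset α :=
  (J.biUnion S).filter fun x => 2 ≤ (J.filter fun i => x ∈ S i).card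

lemma cov_le_aux {α ι : Type*} [DecidableEq α] [DecidableEq ι] (S : ι → Finset α) (M : ℕ) :
    ∀ (n : ℕ) (I : Finset ι), I.card = n → (∀ J ⊆ I, (uniqCov S J).card ≤ M) →
      ((cov S I).card : ℝ) ≤ ((harmonic n : ℚ) : ℝ) * (M : ℝ) := by
  intro n
  induction n with
  | zero =>
    intro I hI _
    rw [Finset.card_eq_zero] at hI
    subst hI
    simp [cov]
  | succ n ih =>
    intro I hI hM
    have hdisj : ((I : Set ι)).PairwiseDisjoint (fun i => cov S I \ cov S (I.erase i)) := by
      intro i hi j hj hij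
      rw [Function.onFun, Finset.disjoint_left]
      intro x hx hx'
      simp only [cov, mem_sdiff, mem_biUnion, mem_erase, not_exists, not_and] at hx hx'
      obtain ⟨⟨k, hk, hxk⟩, h1⟩ := hx
      by_cases hki : k = i
      · subst hki
        exact hx'.2 k ⟨hij, hk⟩ hxk
      · exact h1 k ⟨hki, hk⟩ hxk
    have hsub : I.biUnion (fun i => cov S I \ cov S (I.erase i)) ⊆ uniqCov S I := by
      intro x hx
      simp only [cov, mem_sdiff, mem_biUnion, mem_erase, not_exists, not_and] at hx
      obtain ⟨i, hi, ⟨k, hk, hxk⟩, h1⟩ := hx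
      have hki : k = i := by
        by_contra hki
        exact h1 k ⟨hki, hk⟩ hxk
      subst hki
      simp only [uniqCov, mem_filter, mem_biUnion]
      refine ⟨⟨k, hk, hxk⟩, ?_⟩
      rw [Finset.card_eq_one]
      refine ⟨k, ?_⟩
      ext j
      simp only [mem_filter, mem_singleton]
      constructor
      · rintro ⟨hj, hxj⟩
        by_contra hjk
        exact h1 j ⟨hjk, hj⟩ hxj
      · rintro rfl
        exact ⟨hk, hxk⟩
    have hsum : ∑ i ∈ I, (cov S I \ cov S (I.erase i)).card ≤ M := by
      rw [← Finset.card_biUnion hdisj]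
      exact (Finset.card_le_card hsub).trans (hM I (Finset.Subset.refl _))
    have hne : I.Nonempty := by
      rw [← Finset.card_pos]; omega
    obtain ⟨i, hi, hmin⟩ := Finset.exists_min_image I
      (fun i => (cov S I \ cov S (I.erase i)).card) hne
    have h2 : (n + 1) * (cov S I \ cov S (I.erase i)).card ≤ M := by
      have := Finset.card_nsmul_le_sum I _ _ hmin
      rw [hI, smul_eq_mul] at this
      exact this.trans hsum
    have h3 := ih (I.erase i) (by rw [Finset.card_erase_of_mem hi, hI]; rfl)
      (fun J hJ => hM J (hJ.trans (Finset.erase_subset _ _)))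
    have h4 : (cov S I).card ≤ (cov S I \ cov S (I.erase i)).card + (cov S (I.erase i)).card :=
      Finset.card_le_card_sdiff_add_card
    have h2' : ((n : ℝ) + 1) * ((cov S I \ cov S (I.erase i)).card : ℝ) ≤ M := by
      exact_mod_cast h2
    have h4' : ((cov S I).card : ℝ) ≤
        ((cov S I \ cov S (I.erase i)).card : ℝ) + ((cov S (I.erase i)).card : ℝ) := by
      exact_mod_cast h4
    have hp : (0 : ℝ) < (n : ℝ) + 1 := by positivity
    have h5 : ((cov S I \ cov S (I.erase i)).card : ℝ) ≤ ((n : ℝ) + 1)⁻¹ * M := by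
      rw [inv_mul_eq_div, le_div_iff₀ hp]
      linarith
    rw [harmonic_succ]
    push_cast
    rw [add_mul]
    linarith

/-- Any finite indexed family of finite sets with ℓ = |I| ≥ 1 indices has a
subfamily J ⊆ I with H_ℓ · |Ũ(J)| ≥ |ψ(I)|. -/
theorem stmt_0 {α ι : Type*} [DecidableEq α] [DecidableEq ι]
    (I : Finset ι) (S : ι → Finset α) (hI : 1 ≤ I.card) :
    ∃ J ⊆ I, ((harmonic I.card : ℚ) : ℝ) * ((uniqCov S J).card : ℝ) ≥ ((cov S I).card : ℝ) := by
  obtain ⟨J, hJ, hmax⟩ := Finset.exists_max_image I.powerset (fun J => (uniqCov S J).card)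
    ⟨I, Finset.mem_powerset_self I⟩
  refine ⟨J, Finset.mem_powerset.1 hJ, ?_⟩
  exact cov_le_aux S _ _ I rfl (fun K hK => hmax K (Finset.mem_powerset.2 hK))
end

section
/- Let (S_i)_{i∈I} be a finite indexed family of finite sets whose maximum frequency is at most r, where r ≥ 2 is an integer, and let ε ∈ (0,1) be a real number. Then there exists J ⊆ I such that |Ũ(J)| ≥ (1/H_{⌈r(r−1)/ε⌉} − ε) · |ψ(I)|. -/
open Finset

lemma aux_one {ι : Type*} [DecidableEq ι] (p q : ℝ) (h : p + q = 1) (I : Finset ι) :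
    ∑ J ∈ I.powerset, p ^ J.card * q ^ (I.card - J.card) = 1 := by
  rw [Finset.sum_pow_mul_eq_add_pow, h, one_pow]

lemma aux_prob {ι : Type*} [DecidableEq ι] (p q : ℝ) (h : p + q = 1) (P : ι → Prop)
    [DecidablePred P] (I : Finset ι) :
    (∑ J ∈ I.powerset, p ^ J.card * q ^ (I.card - J.card) *
      (if (J.filter P).card = 0 then (1 : ℝ) else 0) = q ^ (I.filter P).card) ∧
    (∑ J ∈ I.powerset, p ^ J.card * q ^ (I.card - J.card) *
      (if (J.filter P).card = 1 then (1 : ℝ) else 0) =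
      (I.filter P).card * p * q ^ ((I.filter P).card - 1)) := by
  induction I using Finset.induction_on with
  | empty => simp
  | insert a I ha ih =>
    obtain ⟨ih0, ih1⟩ := ih
    have key : ∀ g : Finset ι → ℝ, ∑ J ∈ (insert a I).powerset,
        p ^ J.card * q ^ ((insert a I).card - J.card) * g J =
        q * ∑ J ∈ I.powerset, p ^ J.card * q ^ (I.card - J.card) * g J +
        p * ∑ J ∈ I.powerset, p ^ J.card * q ^ (I.card - J.card) * g (insert a J) := by
      intro g
      rw [Finset.sum_powerset_insert ha, Finset.mul_sum, Finset.mul_sum]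
      congr 1
      · refine Finset.sum_congr rfl fun J hJ => ?_
        have hc := Finset.card_le_card (Finset.mem_powerset.1 hJ)
        rw [Finset.card_insert_of_notMem ha, Nat.sub_add_comm hc, pow_succ]
        ring
      · refine Finset.sum_congr rfl fun J hJ => ?_
        have haJ : a ∉ J := fun h' => ha (Finset.mem_powerset.1 hJ h')
        rw [Finset.card_insert_of_notMem ha, Finset.card_insert_of_notMem haJ,
          Nat.add_sub_add_right, pow_succ]
        ring
    rw [key fun J => if (J.filter P).card = 0 then (1 : ℝ) else 0,
      key fun J => if (J.filter P).card = 1 then (1 : ℝ) else 0, ih0, ih1]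
    by_cases hP : P a
    · have hc : ∀ J ∈ I.powerset, ((insert a J).filter P).card = (J.filter P).card + 1 := by
        intro J hJ
        have haJ : a ∉ J := fun h' => ha (Finset.mem_powerset.1 hJ h')
        rw [Finset.filter_insert, if_pos hP, Finset.card_insert_of_notMem (by simp [haJ])]
      have e0 : ∑ J ∈ I.powerset, p ^ J.card * q ^ (I.card - J.card) *
          (if ((insert a J).filter P).card = 0 then (1 : ℝ) else 0) = 0 := by
        refine Finset.sum_eq_zero fun J hJ => ?_
        rw [hc J hJ]; simp
      have e1 : ∑ J ∈ I.powerset, p ^ J.card * q ^ (I.card - J.card) *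
          (if ((insert a J).filter P).card = 1 then (1 : ℝ) else 0) = q ^ (I.filter P).card := by
        rw [← ih0]
        refine Finset.sum_congr rfl fun J hJ => ?_
        rw [hc J hJ]; simp
      rw [e0, e1, hc I (by simp)]
      refine ⟨by ring, ?_⟩
      rcases (I.filter P).card with _ | m
      · simp
      · simp only [Nat.add_sub_cancel]; push_cast; ring
    · have hc : ∀ J : Finset ι, (insert a J).filter P = J.filter P := by
        intro J
        rw [Finset.filter_insert, if_neg hP]
      simp only [hc]
      rw [ih0, ih1, ← add_mul, ← add_mul, add_comm q p, h]
      simp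

lemma aux_tel (a b : ℝ) (hb : 0 ≤ b) (hab : b ≤ a) (f : ℕ) :
    a ^ f - b ^ f ≤ f * (a - b) * a ^ (f - 1) := by
  have ha : 0 ≤ a := hb.trans hab
  rcases f with _ | m
  · simp
  · simp only [Nat.add_sub_cancel]
    induction m with
    | zero => simp
    | succ m ih =>
      have h1 : b ^ (m + 1) ≤ a ^ (m + 1) := pow_le_pow_left₀ hb hab _
      have h2 := mul_le_mul_of_nonneg_left ih ha
      have h3 := mul_le_mul_of_nonneg_left h1 (sub_nonneg.2 hab)
      push_cast at *
      have e : a ^ (m + 1 + 1) - b ^ (m + 1 + 1) =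
        a * (a ^ (m + 1) - b ^ (m + 1)) + (a - b) * b ^ (m + 1) := by ring
      rw [e]
      have e2 : ((m : ℝ) + 1 + 1) * (a - b) * a ^ (m + 1) =
        a * (((m : ℝ) + 1) * (a - b) * a ^ m) + (a - b) * a ^ (m + 1) := by ring
      rw [e2]
      linarith

lemma aux_sum (N f : ℕ) (hN : 0 < N) (hf : 0 < f) :
    1 - (f : ℝ) / N ≤ ∑ k ∈ range N, ((k : ℝ) + 1)⁻¹ *
      (f * (((k : ℝ) + 1) / N) * (1 - ((k : ℝ) + 1) / N) ^ (f - 1)) := by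
  have hN' : (0 : ℝ) < N := by exact_mod_cast hN
  have hb : 1 - (f : ℝ) / N ≤ (1 - 1 / (N : ℝ)) ^ f := by
    have h1 : (1 : ℝ) / N ≤ 1 := by
      rw [div_le_one hN']; exact_mod_cast hN
    have := one_add_mul_le_pow (a := -(1 / (N : ℝ))) (by linarith) f
    calc 1 - (f : ℝ) / N = 1 + f * -(1 / (N : ℝ)) := by ring
      _ ≤ _ := this
      _ = _ := by ring
  obtain ⟨M, rfl⟩ : ∃ M, N = M + 1 := ⟨N - 1, by omega⟩
  set N : ℝ := ((M + 1 : ℕ) : ℝ) with hNdef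
  have htel : ∑ k ∈ range M, ((1 - ((k : ℝ) + 1) / N) ^ f - (1 - (((k + 1 : ℕ) : ℝ) + 1) / N) ^ f)
      = (1 - 1 / N) ^ f := by
    rw [Finset.sum_range_sub' (fun k : ℕ => (1 - ((k : ℝ) + 1) / N) ^ f) M]
    have : (1 : ℝ) - ((M : ℝ) + 1) / N = 0 := by
      rw [hNdef]; push_cast; rw [div_self (by positivity)]; ring
    rw [this, zero_pow hf.ne']; simp
  refine hb.trans ?_
  rw [← htel, Finset.sum_range_succ]
  have hle : ∀ k : ℕ, k ≤ M → 0 ≤ 1 - ((k : ℝ) + 1) / N := by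
    intro k hk
    rw [sub_nonneg, div_le_one hN', hNdef]
    exact_mod_cast Nat.succ_le_succ hk
  have hterm : 0 ≤ ((M : ℝ) + 1)⁻¹ *
      (f * (((M : ℝ) + 1) / N) * (1 - ((M : ℝ) + 1) / N) ^ (f - 1)) := by
    have := hle M le_rfl
    positivity
  refine le_add_of_le_of_nonneg (Finset.sum_le_sum fun k hk => ?_) hterm
  have hk' := Finset.mem_range.1 hk
  have h1 := hle (k + 1) hk'
  have e : (1 - ((k : ℝ) + 1) / N) - (1 - (((k + 1 : ℕ) : ℝ) + 1) / N) = 1 / N := by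
    push_cast; field_simp; ring
  have hpos : 0 < 1 / N := by positivity
  have := aux_tel (1 - ((k : ℝ) + 1) / N) (1 - (((k + 1 : ℕ) : ℝ) + 1) / N) h1 (by linarith) f
  rw [e] at this
  refine this.trans (le_of_eq ?_)
  have hk0 : (k : ℝ) + 1 ≠ 0 := by positivity
  generalize (1 - ((k : ℝ) + 1) / N) ^ (f - 1) = z
  field_simp

theorem stmt_1 {α ι : Type*} [DecidableEq α] [DecidableEq ι]
    (I : Finset ι) (S : ι → Finset α) (r : ℕ) (hr : 2 ≤ r)
    (hfreq : ∀ x, (I.filter fun i => x ∈ S i).card ≤ r)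
    (ε : ℝ) (hε : ε ∈ Set.Ioo (0 : ℝ) 1) :
    ∃ J ⊆ I, ((uniqCov S J).card : ℝ) ≥
      (1 / ((harmonic ⌈(r : ℝ) * ((r : ℝ) - 1) / ε⌉₊ : ℚ) : ℝ) - ε) * ((cov S I).card : ℝ) := by
  obtain ⟨hε0, hε1⟩ := hε
  have hr' : (2 : ℝ) ≤ r := by exact_mod_cast hr
  have hle := Nat.le_ceil ((r : ℝ) * ((r : ℝ) - 1) / ε)
  generalize ⌈(r : ℝ) * ((r : ℝ) - 1) / ε⌉₊ = N at hle
  have hN0 : (0 : ℝ) < N := lt_of_lt_of_le (div_pos (by nlinarith) hε0) hle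
  have hN : 0 < N := by exact_mod_cast hN0
  have hrN : (r : ℝ) / N ≤ ε := by
    rw [div_le_iff₀ hN0]
    rw [div_le_iff₀ hε0] at hle
    nlinarith
  have hH : ((harmonic N : ℚ) : ℝ) = ∑ k ∈ range N, ((k : ℝ) + 1)⁻¹ := by
    simp [harmonic]
  have hH1 : 1 ≤ ((harmonic N : ℚ) : ℝ) := by
    rw [hH]
    have := Finset.single_le_sum (f := fun k : ℕ => ((k : ℝ) + 1)⁻¹) (s := range N)
      (fun k _ => by positivity) (Finset.mem_range.2 hN)
    simpa using this
  obtain ⟨J, hJ, hmax⟩ := Finset.exists_max_image I.powerset (fun J => (uniqCov S J).card)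
    ⟨∅, by simp⟩
  refine ⟨J, Finset.mem_powerset.1 hJ, ?_⟩
  have hU : ∀ K ∈ I.powerset, ((uniqCov S K).card : ℝ) =
      ∑ x ∈ cov S I, if (K.filter fun i => x ∈ S i).card = 1 then (1 : ℝ) else 0 := by
    intro K hK
    rw [Finset.sum_boole]
    congr 2
    ext x
    simp only [uniqCov, cov, Finset.mem_filter, Finset.mem_biUnion]
    constructor
    · rintro ⟨⟨i, hi, hx⟩, h⟩
      exact ⟨⟨i, Finset.mem_powerset.1 hK hi, hx⟩, h⟩
    · rintro ⟨-, h⟩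
      obtain ⟨i, hi⟩ := Finset.card_pos.1 (by omega : 0 < (K.filter fun i => x ∈ S i).card)
      rw [Finset.mem_filter] at hi
      exact ⟨⟨i, hi⟩, h⟩
  set w : ℕ → Finset ι → ℝ := fun k K =>
    (((k : ℝ) + 1) / N) ^ K.card * (1 - ((k : ℝ) + 1) / N) ^ (I.card - K.card) with hw
  have hw0 : ∀ k ∈ range N, ∀ K, 0 ≤ w k K := by
    intro k hk K
    have : 0 ≤ 1 - ((k : ℝ) + 1) / N := by
      rw [sub_nonneg, div_le_one hN0]
      exact_mod_cast Finset.mem_range.1 hk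
    positivity
  have hupper : ∑ k ∈ range N, ((k : ℝ) + 1)⁻¹ * ∑ K ∈ I.powerset, w k K * (uniqCov S K).card
      ≤ (harmonic N : ℚ) * ((uniqCov S J).card : ℝ) := by
    rw [hH, Finset.sum_mul]
    refine Finset.sum_le_sum fun k hk => mul_le_mul_of_nonneg_left ?_ (by positivity)
    calc ∑ K ∈ I.powerset, w k K * ((uniqCov S K).card : ℝ)
        ≤ ∑ K ∈ I.powerset, w k K * ((uniqCov S J).card : ℝ) := by
          refine Finset.sum_le_sum fun K hK => mul_le_mul_of_nonneg_left ?_ (hw0 k hk K)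
          exact_mod_cast hmax K hK
      _ = (uniqCov S J).card := by
          rw [← Finset.sum_mul, hw, aux_one _ _ (by ring), one_mul]
  have hlower : (1 - (r : ℝ) / N) * (cov S I).card ≤
      ∑ k ∈ range N, ((k : ℝ) + 1)⁻¹ * ∑ K ∈ I.powerset, w k K * (uniqCov S K).card := by
    have e : ∑ k ∈ range N, ((k : ℝ) + 1)⁻¹ * ∑ K ∈ I.powerset, w k K * (uniqCov S K).card =
        ∑ x ∈ cov S I, ∑ k ∈ range N, ((k : ℝ) + 1)⁻¹ *
          (((I.filter fun i => x ∈ S i).card : ℝ) * (((k : ℝ) + 1) / N) *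
            (1 - ((k : ℝ) + 1) / N) ^ ((I.filter fun i => x ∈ S i).card - 1)) := by
      rw [Finset.sum_comm]
      refine Finset.sum_congr rfl fun k _ => ?_
      rw [← Finset.mul_sum]
      congr 1
      rw [Finset.sum_congr rfl fun K hK => by rw [hU K hK, Finset.mul_sum], Finset.sum_comm]
      refine Finset.sum_congr rfl fun x _ => ?_
      exact (aux_prob _ _ (by ring) (fun i => x ∈ S i) I).2
    rw [e, mul_comm, ← nsmul_eq_mul]
    refine Finset.card_nsmul_le_sum _ _ _ fun x hx => ?_
    have hf : 0 < (I.filter fun i => x ∈ S i).card := by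
      simp only [cov, Finset.mem_biUnion] at hx
      obtain ⟨i, hi⟩ := hx
      exact Finset.card_pos.2 ⟨i, Finset.mem_filter.2 hi⟩
    refine le_trans ?_ (aux_sum N _ hN hf)
    have : ((I.filter fun i => x ∈ S i).card : ℝ) ≤ r := by exact_mod_cast hfreq x
    gcongr
  have hfin := hlower.trans hupper
  generalize ((harmonic N : ℚ) : ℝ) = H at *
  have hHpos : 0 < H := by linarith
  rw [ge_iff_le, ← mul_le_mul_iff_right₀ hHpos]
  refine le_trans ?_ hfin
  rw [← mul_assoc]
  refine mul_le_mul_of_nonneg_right ?_ (by positivity)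
  rw [mul_sub, mul_one_div_cancel hHpos.ne']
  nlinarith
end

section
/- For every integer r ≥ 2, setting ε_r = 1/((9.28 ln r)·(2 ln r + 2 ln ln r + 5.61)), one has ε_r ∈ (0,1) and 1/H_{⌈r(r−1)/ε_r⌉} − ε_r ≥ (1 − 1/(9.28 ln r)) / (2 ln r + 2 ln ln r + 5.61) > 0. -/
/-- For every integer r ≥ 2, setting
ε_r = 1/((9.28 ln r)·(2 ln r + 2 ln ln r + 5.61)), one has ε_r ∈ (0,1) and
1/H_{⌈r(r−1)/ε_r⌉} − ε_r ≥ (1 − 1/(9.28 ln r)) / (2 ln r + 2 ln ln r + 5.61) > 0. -/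
theorem stmt_2 (r : ℕ) (hr : 2 ≤ r)
    (εr : ℝ)
    (hεr : εr = 1 / ((9.28 * Real.log r) * (2 * Real.log r + 2 * Real.log (Real.log r) + 5.61))) :
    εr ∈ Set.Ioo (0 : ℝ) 1 ∧
    1 / ((harmonic ⌈(r : ℝ) * ((r : ℝ) - 1) / εr⌉₊ : ℚ) : ℝ) - εr ≥
      (1 - 1 / (9.28 * Real.log r)) / (2 * Real.log r + 2 * Real.log (Real.log r) + 5.61) ∧
    (0 : ℝ) < (1 - 1 / (9.28 * Real.log r)) / (2 * Real.log r + 2 * Real.log (Real.log r) + 5.61) := by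
  have hl2 := Real.log_two_gt_d9
  have hl2' := Real.log_two_lt_d9
  have hr' : (2:ℝ) ≤ r := by exact_mod_cast hr
  have hL : (0.693:ℝ) < Real.log r := by
    have := Real.log_le_log (by norm_num) hr'
    linarith
  have h2L : (2:ℝ) * Real.log r = Real.log ((r:ℝ)^2) := by
    rw [Real.log_pow]; norm_num
  set L := Real.log r with hLdef
  have hL0 : 0 < L := by linarith
  have hlog1 : Real.log L ≤ L - 1 := Real.log_le_sub_one_of_pos hL0
  have hlog2 : 1 - L⁻¹ ≤ Real.log L := Real.one_sub_inv_le_log_of_pos hL0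
  have hinv : L⁻¹ ≤ 1.45 := by
    rw [inv_le_comm₀ hL0 (by norm_num)]; norm_num; linarith
  set A := 2 * L + 2 * Real.log L + 5.61 with hA
  have hA6 : 6 < A := by rw [hA]; linarith
  have hA0 : 0 < A := by linarith
  have hAL : A ≤ 9.3 * L := by rw [hA]; linarith
  have hB : 1 < 9.28 * L := by linarith
  have hBA : 1 < 9.28 * L * A := by nlinarith
  have hx : (r:ℝ) * (r - 1) / εr = r * (r - 1) * (9.28 * L * A) := by
    rw [hεr]; field_simp
  have hH : ((harmonic ⌈(r : ℝ) * ((r : ℝ) - 1) / εr⌉₊ : ℚ) : ℝ) ≤ A := by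
    rw [hx]
    have hxp : 0 < (r:ℝ) * (r - 1) * (9.28 * L * A) := by
      have : (0:ℝ) < r - 1 := by linarith
      positivity
    have hc := Nat.ceil_lt_add_one hxp.le
    have hcp : 0 < ⌈(r:ℝ) * (r - 1) * (9.28 * L * A)⌉₊ := Nat.ceil_pos.2 hxp
    set n := ⌈(r:ℝ) * (r - 1) * (9.28 * L * A)⌉₊
    have hn0 : (0:ℝ) < n := by exact_mod_cast hcp
    refine (harmonic_le_one_add_log n).trans ?_
    have hle : (n:ℝ) ≤ r^2 * (L^2 * 86.304) := by
      have h1 : (n:ℝ) ≤ r^2 * (9.28 * L * A) := by nlinarith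
      refine h1.trans ?_
      refine mul_le_mul_of_nonneg_left ?_ (by positivity)
      have := mul_le_mul_of_nonneg_left hAL hL0.le
      nlinarith
    have hlg := Real.log_le_log hn0 hle
    rw [Real.log_mul (by positivity) (by positivity), Real.log_mul (by positivity) (by norm_num),
      ← h2L, Real.log_pow] at hlg
    have h86 : 2 * Real.log 86.304 ≤ 13 * Real.log 2 := by
      have : Real.log ((86.304:ℝ)^2) ≤ Real.log ((2:ℝ)^13) :=
        Real.log_le_log (by norm_num) (by norm_num)
      rw [Real.log_pow, Real.log_pow] at this
      exact_mod_cast this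
    push_cast at hlg
    rw [hA]; linarith
  have hHpos : (0:ℝ) < ((harmonic ⌈(r : ℝ) * ((r : ℝ) - 1) / εr⌉₊ : ℚ) : ℝ) := by
    have : 0 < ⌈(r : ℝ) * ((r : ℝ) - 1) / εr⌉₊ := by
      rw [hx]
      apply Nat.ceil_pos.2
      have : (0:ℝ) < r - 1 := by linarith
      positivity
    exact_mod_cast harmonic_pos this.ne'
  have hB1 : 1 / (9.28 * L) < 1 := by
    rw [div_lt_one (by linarith)]; exact hB
  refine ⟨⟨?_, ?_⟩, ?_, ?_⟩
  · rw [hεr]; positivity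
  · rw [hεr, div_lt_one (by linarith)]; exact hBA
  · have h1 := one_div_le_one_div_of_le hHpos hH
    have h2 : (1 - 1 / (9.28 * L)) / A = 1 / A - εr := by
      rw [hεr]; field_simp
    rw [h2]; linarith
  · exact div_pos (by linarith) hA0
end

section
/- Let (S_i)_{i∈I} be a finite indexed family of finite sets whose maximum frequency is at most r, where r ≥ 2 is an integer. Then there exists J ⊆ I such that |Ũ(J)| ≥ ((1 − 1/(9.28 ln r)) / (2 ln r + 2 ln ln r + 5.61)) · |ψ(I)|. -/
open Finset

theorem aux_E {ι : Type*} [DecidableEq ι] (P : ι → Prop) [DecidablePred P] (p q : ℝ)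
    (hpq : p + q = 1) (I : Finset ι) :
    (∑ J ∈ I.powerset, p ^ J.card * q ^ (I.card - J.card) *
      (if (J.filter P).card = 0 then (1:ℝ) else 0)) = q ^ (I.filter P).card ∧
    (∑ J ∈ I.powerset, p ^ J.card * q ^ (I.card - J.card) *
      (if (J.filter P).card = 1 then (1:ℝ) else 0)) =
        (I.filter P).card * p * q ^ ((I.filter P).card - 1) := by
  induction I using Finset.induction_on with
  | empty => simp
  | insert a s ha ih =>
    obtain ⟨ih0, ih1⟩ := ih
    have key : ∀ k : ℕ, (∑ J ∈ (insert a s).powerset, p ^ J.card * q ^ ((insert a s).card - J.card) *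
        (if (J.filter P).card = k then (1:ℝ) else 0)) =
        q * (∑ J ∈ s.powerset, p ^ J.card * q ^ (s.card - J.card) *
          (if (J.filter P).card = k then (1:ℝ) else 0)) +
        p * (∑ J ∈ s.powerset, p ^ J.card * q ^ (s.card - J.card) *
          (if (J.filter P).card + (if P a then 1 else 0) = k then (1:ℝ) else 0)) := by
      intro k
      rw [Finset.sum_powerset_insert ha, Finset.mul_sum, Finset.mul_sum]
      congr 1
      · refine Finset.sum_congr rfl fun J hJ => ?_
        have hc := Finset.card_le_card (Finset.mem_powerset.1 hJ)
        rw [Finset.card_insert_of_notMem ha, Nat.succ_sub hc, pow_succ]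
        ring
      · refine Finset.sum_congr rfl fun J hJ => ?_
        have haJ : a ∉ J := fun h => ha (Finset.mem_powerset.1 hJ h)
        rw [Finset.card_insert_of_notMem ha, Finset.card_insert_of_notMem haJ,
          Nat.add_sub_add_right, pow_succ, Finset.filter_insert]
        by_cases hP : P a
        · rw [if_pos hP, if_pos hP, Finset.card_insert_of_notMem (by simp [haJ])]
          ring
        · rw [if_neg hP, if_neg hP, add_zero]
          ring
    rw [key 0, key 1, Finset.filter_insert]
    by_cases hP : P a
    · simp only [hP, if_true]
      rw [Finset.card_insert_of_notMem (by simp [ha])]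
      simp only [Nat.add_eq_right, Nat.add_sub_cancel]
      rw [ih0, ih1]
      constructor
      · simp; ring
      · rcases (s.filter P).card with _ | m
        · simp
        · simp [pow_succ]; ring
    · simp only [hP, if_false, add_zero]
      rw [ih0, ih1]
      constructor <;> rw [← add_mul, add_comm q p, hpq, one_mul]

theorem aux_calc (M : ℝ) {α : Type*} (T : Finset α) (f : α → ℕ) (r : ℕ) (hr : 1 ≤ r)
    (hf : ∀ x ∈ T, 1 ≤ f x ∧ f x ≤ r)
    (h : ∀ p : ℝ, 0 < p → p < 1 → ∑ x ∈ T, (f x : ℝ) * p * (1 - p) ^ (f x - 1) ≤ M) :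
    (T.card : ℝ) ≤ M * (2 * Real.log r + 2 * Real.log 2) := by
  have hr' : (1:ℝ) ≤ r := by exact_mod_cast hr
  set g : ℝ → ℝ := fun p => M * Real.log p + ∑ x ∈ T, (1 - p) ^ f x with hg
  have hd : ∀ p : ℝ, 0 < p → HasDerivAt g
      (M * p⁻¹ + ∑ x ∈ T, (f x : ℝ) * (1 - p) ^ (f x - 1) * (-1)) p := by
    intro p hp
    refine ((Real.hasDerivAt_log hp.ne').const_mul M).add ?_
    refine HasDerivAt.fun_sum fun x _ => ?_
    exact ((hasDerivAt_id p).const_sub 1).pow (f x)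
  have ha : (0:ℝ) < 1 / (2 * r) := by positivity
  have ha1 : (1:ℝ) / (2 * r) ≤ 1 := by
    rw [div_le_one (by positivity)]; linarith
  have hmono : MonotoneOn g (Set.Icc (1 / (2 * r : ℝ)) 1) := by
    refine monotoneOn_of_deriv_nonneg (convex_Icc _ _) ?_ ?_ ?_
    · intro p hp
      exact (hd p (ha.trans_le hp.1)).continuousAt.continuousWithinAt
    · intro p hp
      rw [interior_Icc] at hp
      exact (hd p (ha.trans hp.1)).differentiableAt.differentiableWithinAt
    · intro p hp
      rw [interior_Icc] at hp
      have hp0 := ha.trans hp.1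
      rw [(hd p hp0).deriv]
      have h1 := h p hp0 hp.2
      have h2 : ∑ x ∈ T, (f x : ℝ) * p * (1 - p) ^ (f x - 1) =
          p * ∑ x ∈ T, (f x : ℝ) * (1 - p) ^ (f x - 1) := by
        rw [Finset.mul_sum]; exact Finset.sum_congr rfl fun x _ => by ring
      rw [h2] at h1
      rw [← Finset.sum_mul]
      have : ∑ x ∈ T, (f x : ℝ) * (1 - p) ^ (f x - 1) ≤ M * p⁻¹ := by
        rw [← div_eq_mul_inv, le_div_iff₀ hp0]; linarith
      linarith
  have h1 := hmono (Set.left_mem_Icc.2 ha1) (Set.right_mem_Icc.2 ha1) ha1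
  have hg1 : g 1 = 0 := by
    simp only [hg, Real.log_one, mul_zero, sub_self, zero_add]
    refine Finset.sum_eq_zero fun x hx => ?_
    exact zero_pow (by have := (hf x hx).1; omega)
  rw [hg1] at h1
  have h3 : (T.card : ℝ) * (1 / 2) ≤ ∑ x ∈ T, (1 - 1 / (2 * r : ℝ)) ^ f x := by
    rw [← nsmul_eq_mul]
    refine Finset.card_nsmul_le_sum _ _ _ fun x hx => ?_
    have hb := one_add_mul_le_pow (a := -(1 / (2 * r : ℝ))) (by linarith) (f x)
    have hfr : (f x : ℝ) ≤ r := by exact_mod_cast (hf x hx).2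
    have : (f x : ℝ) * (1 / (2 * r : ℝ)) ≤ 1 / 2 := by
      rw [mul_one_div, div_le_iff₀ (by positivity)]; linarith
    rw [← sub_eq_add_neg] at hb
    linarith
  have hlog : Real.log (1 / (2 * r : ℝ)) = -(Real.log 2 + Real.log r) := by
    rw [one_div, Real.log_inv, Real.log_mul (by norm_num) (by positivity)]
  simp only [hg] at h1
  rw [hlog] at h1
  linarith

/-- If the maximum frequency of the family is at most r (r ≥ 2), then some
subfamily J ⊆ I has |Ũ(J)| ≥ ((1 − 1/(9.28 ln r)) / (2 ln r + 2 ln ln r + 5.61)) · |ψ(I)|. -/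
theorem stmt_3 {α ι : Type*} [DecidableEq α] [DecidableEq ι]
    (I : Finset ι) (S : ι → Finset α) (r : ℕ) (hr : 2 ≤ r)
    (hfreq : ∀ x, (I.filter fun i => x ∈ S i).card ≤ r) :
    ∃ J ⊆ I, ((uniqCov S J).card : ℝ) ≥
      ((1 - 1 / (9.28 * Real.log r)) / (2 * Real.log r + 2 * Real.log (Real.log r) + 5.61)) *
        ((cov S I).card : ℝ) := by
  obtain ⟨J₀, hJ₀, hmax⟩ := Finset.exists_max_image I.powerset (fun J => (uniqCov S J).card)
    ⟨∅, Finset.empty_mem_powerset I⟩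
  refine ⟨J₀, Finset.mem_powerset.1 hJ₀, ?_⟩
  set M : ℝ := ((uniqCov S J₀).card : ℝ) with hM
  have hU : ∀ J ∈ I.powerset, ((uniqCov S J).card : ℝ) =
      ∑ x ∈ cov S I, (if (J.filter fun i => x ∈ S i).card = 1 then (1:ℝ) else 0) := by
    intro J hJ
    rw [Finset.sum_boole]
    congr 2
    ext x
    simp only [uniqCov, cov, Finset.mem_filter, Finset.mem_biUnion]
    constructor
    · rintro ⟨⟨i, hi, hx⟩, h⟩
      exact ⟨⟨i, Finset.mem_powerset.1 hJ hi, hx⟩, h⟩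
    · rintro ⟨_, h⟩
      refine ⟨?_, h⟩
      obtain ⟨i, hi⟩ := Finset.card_pos.1 (by omega : 0 < (J.filter fun i => x ∈ S i).card)
      exact ⟨i, Finset.mem_filter.1 hi⟩
  have hmain := aux_calc M (cov S I) (fun x => (I.filter fun i => x ∈ S i).card) r (by omega)
    (by
      intro x hx
      refine ⟨Finset.card_pos.2 ?_, hfreq x⟩
      obtain ⟨i, hi, hxi⟩ := Finset.mem_biUnion.1 hx
      exact ⟨i, Finset.mem_filter.2 ⟨hi, hxi⟩⟩)
    (by
      intro p hp0 hp1
      have hq : 0 < 1 - p := by linarith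
      have e1 : ∑ x ∈ cov S I, (((I.filter fun i => x ∈ S i).card : ℕ) : ℝ) * p *
          (1 - p) ^ ((I.filter fun i => x ∈ S i).card - 1) =
          ∑ J ∈ I.powerset, p ^ J.card * (1 - p) ^ (I.card - J.card) *
            ((uniqCov S J).card : ℝ) := by
        rw [Finset.sum_congr rfl fun x _ =>
          (aux_E (fun i => x ∈ S i) p (1 - p) (by ring) I).2.symm, Finset.sum_comm]
        refine Finset.sum_congr rfl fun J hJ => ?_
        rw [hU J hJ, Finset.mul_sum]
      rw [e1]
      calc _ ≤ ∑ J ∈ I.powerset, p ^ J.card * (1 - p) ^ (I.card - J.card) * M := by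
            refine Finset.sum_le_sum fun J hJ => ?_
            have : ((uniqCov S J).card : ℝ) ≤ M := Nat.cast_le.2 (hmax J hJ)
            gcongr
        _ = M := by
            rw [← Finset.sum_mul, Finset.sum_pow_mul_eq_add_pow]
            simp)
  have hM0 : 0 ≤ M := Nat.cast_nonneg _
  have hl2 := Real.log_two_gt_d9
  have hl2' := Real.log_two_lt_d9
  have hL : Real.log 2 ≤ Real.log r := Real.log_le_log (by norm_num) (by exact_mod_cast hr)
  have hLpos : 0 < Real.log r := by linarith
  have hLL : -1 ≤ Real.log (Real.log r) := by
    have := Real.one_sub_inv_le_log_of_pos hLpos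
    have h2 : (Real.log r)⁻¹ ≤ 2 := by
      rw [inv_le_comm₀ hLpos (by norm_num)]; norm_num; linarith
    linarith
  have hD : 2 * Real.log r + 2 * Real.log 2 ≤
      2 * Real.log r + 2 * Real.log (Real.log r) + 5.61 := by norm_num; linarith
  have hDpos : 0 < 2 * Real.log r + 2 * Real.log (Real.log r) + 5.61 := by linarith
  have hnum : 1 - 1 / (9.28 * Real.log r) ≤ 1 := by
    have : 0 ≤ 1 / (9.28 * Real.log r) := by positivity
    linarith
  have hc0 : (0:ℝ) ≤ ((cov S I).card : ℝ) := Nat.cast_nonneg _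
  rw [ge_iff_le, div_mul_eq_mul_div, div_le_iff₀ hDpos]
  calc _ ≤ 1 * ((cov S I).card : ℝ) := by gcongr
    _ ≤ M * (2 * Real.log r + 2 * Real.log 2) := by rw [one_mul]; exact hmain
    _ ≤ _ := by gcongr
end

section
/- Let (S_i)_{i∈I} be a finite indexed family of finite sets in which every set satisfies |S_i| ≤ d, where d ≥ 2 is an integer, and let ε ∈ (0,1) and ε̂ ∈ (0,1) be real numbers. Define β(d, ε̂) = 1/H_{⌈d(d−1)/ε̂⌉} − ε̂. Then there exists J ⊆ I such that |Ũ(J)| ≥ min(ε, (1−ε)·β(d, ε̂)) · |ψ(I)|. -/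
open Finset

lemma aux_prob_s4 {ι : Type*} [DecidableEq ι] (J T : Finset ι) (hT : T ⊆ J) (i0 : ι) (hi : i0 ∈ T)
    (p q : ℝ) (hpq : p + q = 1) :
    ∑ A ∈ J.powerset, (if A ∩ T = {i0} then p ^ A.card * q ^ (J \ A).card else 0)
      = p * q ^ (T.card - 1) := by
  classical
  have h := Finset.prod_add (fun i => if i ∈ T ∧ i ≠ i0 then (0:ℝ) else p)
    (fun i => if i = i0 then (0:ℝ) else q) J
  have h1 : ∏ i ∈ J, ((if i ∈ T ∧ i ≠ i0 then (0:ℝ) else p) + (if i = i0 then (0:ℝ) else q))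
      = p * q ^ (T.card - 1) := by
    rw [← Finset.prod_sdiff hT, Finset.prod_eq_one, one_mul, ← Finset.mul_prod_erase T _ hi]
    · congr 1
      · simp
      · rw [← Finset.card_erase_of_mem hi, Finset.prod_congr rfl (g := fun _ => q)]
        · simp
        · intro x hx
          have := Finset.mem_erase.1 hx
          simp [this.1, this.2]
    · intro x hx
      have := Finset.mem_sdiff.1 hx
      have hne : x ≠ i0 := fun h => this.2 (h ▸ hi)
      simp [this.2, hne, hpq]
  rw [← h1, h]
  refine Finset.sum_congr rfl fun A hA => ?_
  have hA := Finset.mem_powerset.1 hA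
  split_ifs with hAT
  · have hi0 : i0 ∈ A := by
      have : i0 ∈ A ∩ T := by rw [hAT]; simp
      exact (Finset.mem_inter.1 this).1
    congr 1
    · rw [Finset.prod_congr rfl (g := fun _ => p)]
      · simp
      · intro x hx
        rw [if_neg]
        rintro ⟨h1, h2⟩
        have : x ∈ A ∩ T := Finset.mem_inter.2 ⟨hx, h1⟩
        rw [hAT] at this
        exact h2 (Finset.mem_singleton.1 this)
    · rw [Finset.prod_congr rfl (g := fun _ => q)]
      · simp
      · intro x hx
        rw [if_neg]
        rintro rfl
        exact (Finset.mem_sdiff.1 hx).2 hi0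
  · symm
    by_cases hi0 : i0 ∈ A
    · have : ∃ x ∈ A, x ∈ T ∧ x ≠ i0 := by
        by_contra hc
        push Not at hc
        apply hAT
        ext x
        simp only [Finset.mem_inter, Finset.mem_singleton]
        constructor
        · rintro ⟨a, b⟩
          exact hc x a b
        · rintro rfl
          exact ⟨hi0, hi⟩
      obtain ⟨x, hx, hxT⟩ := this
      rw [Finset.prod_eq_zero hx (by simp [hxT]), zero_mul]
    · rw [Finset.prod_eq_zero (s := J \ A) (i := i0) (Finset.mem_sdiff.2 ⟨hT hi, hi0⟩) (by simp),
        mul_zero]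

lemma aux_M {α ι : Type*} [DecidableEq α] [DecidableEq ι] (S : ι → Finset α) (J : Finset ι)
    (X : Finset α) (M : ℝ)
    (hM : ∀ A ⊆ J, ((uniqCov S A).card : ℝ) ≤ M) (p q : ℝ) (hp : 0 ≤ p) (hq : 0 ≤ q)
    (hpq : p + q = 1) :
    ∑ x ∈ X, ((J.filter fun i => x ∈ S i).card : ℝ) * (p * q ^ ((J.filter fun i => x ∈ S i).card - 1))
      ≤ M := by
  have hone : ∑ A ∈ J.powerset, p ^ A.card * q ^ (J \ A).card = 1 := by
    have h := Finset.prod_add (fun _ : ι => p) (fun _ => q) J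
    simp only [hpq, Finset.prod_const, one_pow] at h
    exact h.symm
  have hx : ∀ x, ((J.filter fun i => x ∈ S i).card : ℝ) *
        (p * q ^ ((J.filter fun i => x ∈ S i).card - 1))
      ≤ ∑ A ∈ J.powerset, (p ^ A.card * q ^ (J \ A).card) * (if x ∈ uniqCov S A then 1 else 0) := by
    intro x
    set T := J.filter fun i => x ∈ S i with hTdef
    have : (T.card : ℝ) * (p * q ^ (T.card - 1)) = ∑ i0 ∈ T, ∑ A ∈ J.powerset,
        (if A ∩ T = {i0} then p ^ A.card * q ^ (J \ A).card else 0) := by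
      rw [Finset.sum_congr rfl fun i0 hi => aux_prob_s4 J T (Finset.filter_subset _ _) i0 hi p q hpq]
      simp
    rw [this, Finset.sum_comm]
    refine Finset.sum_le_sum fun A hA => ?_
    have hA := Finset.mem_powerset.1 hA
    have hnn : 0 ≤ p ^ A.card * q ^ (J \ A).card := by positivity
    by_cases hex : ∃ i ∈ T, A ∩ T = {i}
    · obtain ⟨i, hi, hAi⟩ := hex
      have hAf : (A.filter fun i => x ∈ S i) = {i} := by
        rw [← hAi]
        ext j
        simp only [hTdef, Finset.mem_filter, Finset.mem_inter]
        exact ⟨fun h => ⟨h.1, hA h.1, h.2⟩, fun h => ⟨h.1, h.2.2⟩⟩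
      have hmem : x ∈ uniqCov S A := by
        unfold uniqCov
        rw [Finset.mem_filter]
        refine ⟨?_, by rw [hAf]; simp⟩
        have : i ∈ (A.filter fun i => x ∈ S i) := by rw [hAf]; simp
        rw [Finset.mem_filter] at this
        exact Finset.mem_biUnion.2 ⟨i, this⟩
      rw [if_pos hmem, hAi, mul_one]
      simp only [Finset.singleton_inj]
      rw [Finset.sum_ite_eq, if_pos hi]
    · rw [Finset.sum_eq_zero]
      · split_ifs <;> simp [hnn]
      · intro i hi
        rw [if_neg]
        exact fun h => hex ⟨i, hi, h⟩
  calc _ ≤ ∑ x ∈ X, ∑ A ∈ J.powerset,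
        (p ^ A.card * q ^ (J \ A).card) * (if x ∈ uniqCov S A then 1 else 0) :=
        Finset.sum_le_sum fun x _ => hx x
    _ = ∑ A ∈ J.powerset, (p ^ A.card * q ^ (J \ A).card) *
        ∑ x ∈ X, (if x ∈ uniqCov S A then (1:ℝ) else 0) := by
        rw [Finset.sum_comm]
        simp only [Finset.mul_sum]
    _ ≤ ∑ A ∈ J.powerset, (p ^ A.card * q ^ (J \ A).card) * M := by
        refine Finset.sum_le_sum fun A hA => mul_le_mul_of_nonneg_left ?_ (by positivity)
        refine le_trans ?_ (hM A (Finset.mem_powerset.1 hA))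
        rw [← Finset.sum_filter, Finset.sum_const, nsmul_eq_mul, mul_one]
        exact_mod_cast Finset.card_le_card fun y hy => (Finset.mem_filter.1 hy).2
    _ = M := by rw [← Finset.sum_mul, hone, one_mul]

lemma aux_int {α : Type*} (X : Finset α) (r : α → ℕ) (hr : ∀ x ∈ X, 1 ≤ r x) (M : ℝ) (k : ℕ)
    (hk : 0 < k)
    (h : ∀ q : ℝ, 0 ≤ q → q ≤ 1 → ∑ x ∈ X, (r x : ℝ) * ((1 - q) * q ^ (r x - 1)) ≤ M) :
    (X.card : ℝ) - (∑ x ∈ X, (r x : ℝ)) / k ≤ M * ((harmonic k : ℚ) : ℝ) := by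
  have hpt : ∀ q ∈ Set.Icc (0:ℝ) 1, ∑ x ∈ X, (r x : ℝ) * (q ^ (r x - 1) - q ^ (r x - 1 + k))
      ≤ M * ∑ j ∈ range k, q ^ j := by
    rintro q ⟨h0, h1⟩
    have hg : (1 - q) * ∑ j ∈ range k, q ^ j = 1 - q ^ k := mul_neg_geom_sum q k
    have := mul_le_mul_of_nonneg_right (h q h0 h1)
      (Finset.sum_nonneg (s := range k) fun j _ => pow_nonneg h0 j)
    refine le_trans (le_of_eq ?_) this
    rw [Finset.sum_mul]
    refine Finset.sum_congr rfl fun x _ => ?_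
    rw [pow_add]
    linear_combination (-(r x : ℝ) * q ^ (r x - 1)) * hg
  have hint := intervalIntegral.integral_mono_on (μ := MeasureTheory.volume) zero_le_one
    (Continuous.intervalIntegrable (by fun_prop) _ _)
    (Continuous.intervalIntegrable (by fun_prop) _ _) hpt
  rw [intervalIntegral.integral_finsetSum
      (fun i _ => Continuous.intervalIntegrable (by fun_prop) _ _),
    intervalIntegral.integral_const_mul, intervalIntegral.integral_finsetSum
      (fun i _ => Continuous.intervalIntegrable (by fun_prop) _ _)] at hint
  have hH : ∑ j ∈ range k, ∫ (x : ℝ) in (0:ℝ)..1, x ^ j = ((harmonic k : ℚ) : ℝ) := by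
    rw [harmonic]
    push_cast
    refine Finset.sum_congr rfl fun j _ => ?_
    rw [integral_pow]; simp
  rw [hH] at hint
  refine le_trans ?_ hint
  rw [Finset.sum_div, Finset.card_eq_sum_ones]
  push_cast
  rw [← Finset.sum_sub_distrib]
  refine Finset.sum_le_sum fun x hx => ?_
  rw [intervalIntegral.integral_const_mul, intervalIntegral.integral_sub
    (Continuous.intervalIntegrable (by fun_prop) _ _)
    (Continuous.intervalIntegrable (by fun_prop) _ _), integral_pow, integral_pow]
  obtain ⟨s, hs⟩ : ∃ s, r x = s + 1 := ⟨r x - 1, by have := hr x hx; omega⟩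
  rw [hs]
  have hk' : (0:ℝ) < k := by exact_mod_cast hk
  simp only [Nat.add_sub_cancel]
  push_cast
  have e : ((s:ℝ) + 1) * ((1 ^ (s+1) - 0 ^ (s+1)) / (s + 1) - (1 ^ (s+k+1) - 0 ^ (s+k+1)) / (s + k + 1))
      = 1 - (s+1) / (s+k+1) := by
    have : (s:ℝ) + 1 ≠ 0 := by positivity
    have : (s:ℝ) + k + 1 ≠ 0 := by positivity
    simp
    field_simp
  rw [e]
  have : ((s:ℝ)+1) / (s+k+1) ≤ (s+1)/k := by
    apply div_le_div_of_nonneg_left <;> first | positivity | linarith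
  linarith

lemma aux_min {α ι : Type*} [DecidableEq α] [DecidableEq ι] (S : ι → Finset α) (I : Finset ι) :
    ∃ J ⊆ I, cov S J = cov S I ∧ ∀ i ∈ J, ∃ x ∈ S i, (J.filter fun i => x ∈ S i) = {i} := by
  obtain ⟨J, hJ, hmin⟩ := Finset.exists_min_image (I.powerset.filter fun J => cov S J = cov S I)
    Finset.card ⟨I, by simp⟩
  simp only [Finset.mem_filter, Finset.mem_powerset] at hJ hmin
  refine ⟨J, hJ.1, hJ.2, fun i hi => ?_⟩
  by_contra hc
  push Not at hc
  have := hmin (J.erase i) ⟨(Finset.erase_subset _ _).trans hJ.1, ?_⟩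
  · have h2 := Finset.card_erase_lt_of_mem hi
    omega
  · rw [← hJ.2]
    unfold cov
    apply le_antisymm
    · exact Finset.biUnion_subset_biUnion_of_subset_left _ (Finset.erase_subset _ _)
    · intro x hx
      obtain ⟨j, hj, hxj⟩ := Finset.mem_biUnion.1 hx
      rw [Finset.mem_biUnion]
      by_cases hji : j = i
      · subst hji
        by_contra hcc
        push Not at hcc
        apply hc x hxj
        ext l
        simp only [Finset.mem_filter, Finset.mem_singleton]
        constructor
        · rintro ⟨a, b⟩
          by_contra hne
          exact hcc l (Finset.mem_erase.2 ⟨hne, a⟩) b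
        · rintro rfl
          exact ⟨hi, hxj⟩
      · exact ⟨j, Finset.mem_erase.2 ⟨hji, hj⟩, hxj⟩

/-- If every set of the family has size at most d (d ≥ 2) and ε, ε̂ ∈ (0,1),
then with β(d,ε̂) = 1/H_{⌈d(d−1)/ε̂⌉} − ε̂, some subfamily J ⊆ I has
|Ũ(J)| ≥ min(ε, (1−ε)·β(d,ε̂)) · |ψ(I)|. -/
theorem stmt_4 {α ι : Type*} [DecidableEq α] [DecidableEq ι]
    (I : Finset ι) (S : ι → Finset α) (d : ℕ) (hd : 2 ≤ d)
    (hsize : ∀ i ∈ I, (S i).card ≤ d)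
    (ε εhat : ℝ) (hε : ε ∈ Set.Ioo (0 : ℝ) 1) (hεhat : εhat ∈ Set.Ioo (0 : ℝ) 1) :
    ∃ J ⊆ I, ((uniqCov S J).card : ℝ) ≥
      min ε ((1 - ε) * (1 / ((harmonic ⌈(d : ℝ) * ((d : ℝ) - 1) / εhat⌉₊ : ℚ) : ℝ) - εhat)) *
        ((cov S I).card : ℝ) := by
  classical
  obtain ⟨hε0, hε1⟩ := hε
  obtain ⟨hh0, hh1⟩ := hεhat
  obtain ⟨J, hJI, hcov, hpriv⟩ := aux_min S I
  obtain ⟨A, hA, hAmax⟩ := Finset.exists_max_image J.powerset (fun A => (uniqCov S A).card)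
    ⟨J, by simp⟩
  rw [Finset.mem_powerset] at hA
  refine ⟨A, hA.trans hJI, ?_⟩
  set M : ℝ := ((uniqCov S A).card : ℝ) with hMdef
  have hM : ∀ B ⊆ J, ((uniqCov S B).card : ℝ) ≤ M := fun B hB => by
    rw [hMdef]
    exact_mod_cast hAmax B (Finset.mem_powerset.2 hB)
  set k := ⌈(d : ℝ) * ((d : ℝ) - 1) / εhat⌉₊ with hkdef
  have hd' : (2:ℝ) ≤ d := by exact_mod_cast hd
  have hkle : (d : ℝ) * ((d : ℝ) - 1) / εhat ≤ k := Nat.le_ceil _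
  have hdd : 0 < (d : ℝ) * ((d : ℝ) - 1) := by nlinarith
  have hkpos' : (0:ℝ) < k := lt_of_lt_of_le (by positivity) hkle
  have hkpos : 0 < k := by exact_mod_cast hkpos'
  set X := nonUniqCov S J with hX
  have hXr : ∀ x ∈ X, 2 ≤ (J.filter fun i => x ∈ S i).card := fun x hx => (Finset.mem_filter.1 hx).2
  have hmain := aux_int X (fun x => (J.filter fun i => x ∈ S i).card)
    (fun x hx => by have := hXr x hx; omega) M k hkpos
    (fun q h0 h1 => aux_M S J X M hM (1 - q) q (by linarith) h0 (by ring))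
  -- sum of degrees
  have hdeg : ∑ x ∈ X, ((J.filter fun i => x ∈ S i).card : ℝ) ≤ J.card * ((d:ℝ) - 1) := by
    have h1 : ∑ x ∈ X, (J.filter fun i => x ∈ S i).card
        = ∑ i ∈ J, (X.filter fun x => x ∈ S i).card :=
      Finset.sum_card_bipartiteAbove_eq_sum_card_bipartiteBelow (fun x i => x ∈ S i)
    have h2 : ∑ i ∈ J, (X.filter fun x => x ∈ S i).card ≤ ∑ i ∈ J, (d - 1) := by
      refine Finset.sum_le_sum fun i hi => ?_
      obtain ⟨x, hx, hxi⟩ := hpriv i hi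
      have hs : (X.filter fun x => x ∈ S i) ⊆ (S i).erase x := by
        intro y hy
        rw [Finset.mem_filter] at hy
        refine Finset.mem_erase.2 ⟨?_, hy.2⟩
        rintro rfl
        have := hXr y hy.1
        rw [hxi] at this
        simp at this
      have h3 := Finset.card_le_card hs
      rw [Finset.card_erase_of_mem hx] at h3
      have := hsize i (hJI hi)
      omega
    rw [← h1, Finset.sum_const, smul_eq_mul] at h2
    have h4 : ((∑ x ∈ X, (J.filter fun i => x ∈ S i).card : ℕ) : ℝ) ≤ ((J.card * (d - 1) : ℕ) : ℝ) := by
      exact_mod_cast h2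
    rw [Nat.cast_mul, Nat.cast_sub (by omega)] at h4
    push_cast at h4
    exact h4
  have hJu : J.card ≤ (uniqCov S J).card := by
    rcases J.eq_empty_or_nonempty with hJe | ⟨i₀, hi₀⟩
    · simp [hJe]
    haveI : Nonempty α := ⟨(hpriv i₀ hi₀).choose⟩
    choose! f hf1 hf2 using hpriv
    refine Finset.card_le_card_of_injOn f (fun i hi => ?_) (fun i hi j hj hij => ?_)
    · have hi : i ∈ J := hi
      refine Finset.mem_coe.2 (Finset.mem_filter.2 ⟨Finset.mem_biUnion.2 ⟨i, hi, hf1 i hi⟩, ?_⟩)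
      rw [hf2 i hi]; simp
    · have h1 := hf2 i hi
      rw [hij, hf2 j hj] at h1
      exact (Finset.singleton_inj.1 h1).symm
  have hsum : (uniqCov S J).card + X.card = (cov S J).card := by
    rw [← Finset.card_filter_add_card_filter_not (s := cov S J)
      (p := fun x => (J.filter fun i => x ∈ S i).card = 1)]
    congr 2
    rw [hX]
    unfold nonUniqCov cov
    refine Finset.filter_congr fun x hx => ?_
    obtain ⟨j, hj, hxj⟩ := Finset.mem_biUnion.1 hx
    have : 0 < (J.filter fun i => x ∈ S i).card :=
      Finset.card_pos.2 ⟨j, Finset.mem_filter.2 ⟨hj, hxj⟩⟩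
    omega
  rw [hcov] at hsum
  have hsum' : ((uniqCov S J).card : ℝ) + X.card = (cov S I).card := by exact_mod_cast hsum
  have hJu' : (J.card : ℝ) ≤ (uniqCov S J).card := by exact_mod_cast hJu
  have huM := hM J subset_rfl
  have hH1 : (1:ℝ) ≤ ((harmonic k : ℚ) : ℝ) := by
    have : (1:ℚ) ≤ harmonic k := by
      rw [harmonic]
      have := Finset.single_le_sum (f := fun i : ℕ => ((↑(i + 1) : ℚ))⁻¹) (s := range k)
        (fun i _ => by positivity) (Finset.mem_range.2 hkpos)
      simpa using this
    exact_mod_cast this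
  set H : ℝ := ((harmonic k : ℚ) : ℝ)
  set n : ℝ := ((cov S I).card : ℝ)
  set m : ℝ := (X.card : ℝ)
  set u : ℝ := ((uniqCov S J).card : ℝ)
  set N : ℝ := (J.card : ℝ)
  have hn : 0 ≤ n := Nat.cast_nonneg _
  have hm : 0 ≤ m := Nat.cast_nonneg _
  have hN : 0 ≤ N := Nat.cast_nonneg _
  have hM0 : 0 ≤ M := Nat.cast_nonneg _
  clear_value H n m u N M k
  by_cases hu : ε * n ≤ u
  · exact le_trans (mul_le_mul_of_nonneg_right (min_le_left _ _) hn) (hu.trans huM)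
  push Not at hu
  refine le_trans (mul_le_mul_of_nonneg_right (min_le_right _ _) hn) ?_
  have hHi : 1 / H ≤ 1 := by rw [div_le_one (by linarith)]; exact hH1
  have hkey : (1 / H - εhat) * m ≤ M := by
    rcases le_total m N with h | h
    · nlinarith
    · have h1 : (N * ((d:ℝ) - 1)) / k ≤ εhat * m := by
        rw [div_le_iff₀ hkpos']
        rw [div_le_iff₀ hh0] at hkle
        have : (d:ℝ) - 1 ≤ εhat * k := by nlinarith
        nlinarith
      have h2 : m - εhat * m ≤ M * H := by
        have := div_le_div_of_nonneg_right hdeg hkpos'.le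
        linarith
      have h3 : (m - εhat * m) / H ≤ M := by rwa [div_le_iff₀ (by linarith)]
      have h4 : (m - εhat * m) / H = 1 / H * m - 1 / H * (εhat * m) := by ring
      have h5 : 1 / H * (εhat * m) ≤ εhat * m := by
        have : 0 ≤ εhat * m := by positivity
        nlinarith
      linarith
  by_cases hb : 0 ≤ 1 / H - εhat
  · have : (1 / H - εhat) * ((1 - ε) * n) ≤ (1 / H - εhat) * m :=
      mul_le_mul_of_nonneg_left (by linarith) hb
    linarith
  · push Not at hb
    have : (1 - ε) * (1 / H - εhat) * n ≤ 0 := by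
      have : 0 ≤ (1 - ε) * n := mul_nonneg (by linarith) hn
      nlinarith
    linarith
end

section
/- (Kernelization Lemma.) Let (S_i)_{i∈I} be a finite indexed family of finite sets with maximum frequency at most r (r ≥ 1 an integer), let k ≥ 1 be an integer, ε ∈ (0,1) a real number, and φ > 0 a real number. Assume that for every subset C ⊆ I there exists Q ⊆ C with |Q| ≤ k and φ · |Ũ(Q)| ≥ |ψ(C)|. Let A ⊆ I be a set of the ⌈k·r·(φ+1)/ε⌉ largest sets, i.e., |A| = min(|I|, ⌈k·r·(φ+1)/ε⌉) and |S_i| ≥ |S_j| for all i ∈ A and j ∈ I \ A. Then there exists B ⊆ A with |B| ≤ k and |Ũ(B)| ≥ (1−ε) · OPT, where OPT = max{ |Ũ(Q)| : Q ⊆ I, |Q| ≤ k }. -/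
open Finset

/-- Kernelization Lemma: with maximum frequency at most r, cardinality constraint
k ≥ 1, ε ∈ (0,1), and unique coverage ratio bound φ for every subcollection, the collection A
of the ⌈k·r·(φ+1)/ε⌉ largest sets contains a subcollection B of at most k sets with
|Ũ(B)| ≥ (1−ε)·OPT, where OPT = max{ |Ũ(Q)| : Q ⊆ I, |Q| ≤ k }. -/
theorem stmt_6 {α ι : Type*} [DecidableEq α] [DecidableEq ι]
    (I : Finset ι) (S : ι → Finset α) (r : ℕ) (hr : 1 ≤ r)
    (hfreq : ∀ x, (I.filter fun i => x ∈ S i).card ≤ r)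
    (k : ℕ) (hk : 1 ≤ k) (ε : ℝ) (hε : ε ∈ Set.Ioo (0 : ℝ) 1) (φ : ℝ) (hφ : 0 < φ)
    (hratio : ∀ C ⊆ I, ∃ Q ⊆ C, Q.card ≤ k ∧
      φ * ((uniqCov S Q).card : ℝ) ≥ ((cov S C).card : ℝ))
    (A : Finset ι) (hA : A ⊆ I)
    (hAcard : A.card = min I.card ⌈(k : ℝ) * (r : ℝ) * (φ + 1) / ε⌉₊)
    (hAtop : ∀ i ∈ A, ∀ j ∈ I \ A, (S j).card ≤ (S i).card) :
    ∃ B ⊆ A, B.card ≤ k ∧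
      ∀ Q ⊆ I, Q.card ≤ k →
        ((uniqCov S B).card : ℝ) ≥ (1 - ε) * ((uniqCov S Q).card : ℝ) := by
  classical
  obtain ⟨hε0, hε1⟩ := hε
  -- an optimal subcollection
  obtain ⟨P, hPm, hPmax⟩ := Finset.exists_max_image (I.powerset.filter fun Q => Q.card ≤ k)
    (fun Q => (uniqCov S Q).card) ⟨∅, by simp⟩
  simp only [Finset.mem_filter, Finset.mem_powerset] at hPm hPmax
  obtain ⟨hPI, hPk⟩ := hPm
  have hmax : ∀ Q ⊆ I, Q.card ≤ k → ((uniqCov S Q).card : ℝ) ≤ (uniqCov S P).card := by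
    intro Q h1 h2
    exact_mod_cast hPmax Q ⟨h1, h2⟩
  refine ⟨P ∩ A, Finset.inter_subset_right,
    (Finset.card_le_card Finset.inter_subset_left).trans hPk, ?_⟩
  suffices h : ((uniqCov S (P ∩ A)).card : ℝ) ≥ (1 - ε) * ((uniqCov S P).card : ℝ) by
    intro Q h1 h2
    have := mul_le_mul_of_nonneg_left (hmax Q h1 h2) (by linarith : (0:ℝ) ≤ 1 - ε)
    linarith
  -- dropping the small sets
  have hsub : uniqCov S P ⊆ uniqCov S (P ∩ A) ∪ (P \ A).biUnion S := by
    intro x hx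
    simp only [uniqCov, Finset.mem_filter, Finset.mem_biUnion, Finset.mem_union] at hx ⊢
    obtain ⟨⟨i, hi, hxi⟩, hc⟩ := hx
    by_cases hiA : i ∈ A
    · left
      have hmem : i ∈ P ∩ A := Finset.mem_inter.2 ⟨hi, hiA⟩
      refine ⟨⟨i, hmem, hxi⟩, ?_⟩
      apply le_antisymm
      · rw [← hc]
        exact Finset.card_le_card (Finset.filter_subset_filter _ Finset.inter_subset_left)
      · exact Finset.card_pos.2 ⟨i, Finset.mem_filter.2 ⟨hmem, hxi⟩⟩
    · right
      exact ⟨i, Finset.mem_sdiff.2 ⟨hi, hiA⟩, hxi⟩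
  have hcard : (uniqCov S P).card ≤ (uniqCov S (P ∩ A)).card + ∑ j ∈ P \ A, (S j).card :=
    (Finset.card_le_card hsub).trans ((Finset.card_union_le _ _).trans
      (Nat.add_le_add_left Finset.card_biUnion_le _))
  have hcardR : ((uniqCov S P).card : ℝ) ≤ (uniqCov S (P ∩ A)).card
      + ((∑ j ∈ P \ A, (S j).card : ℕ) : ℝ) := by exact_mod_cast hcard
  have hO : (0:ℝ) ≤ (uniqCov S P).card := Nat.cast_nonneg _
  rcases le_total I.card ⌈(k : ℝ) * (r : ℝ) * (φ + 1) / ε⌉₊ with hle | hle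
  · rw [min_eq_left hle] at hAcard
    have hAI : A = I := Finset.eq_of_subset_of_card_le hA hAcard.ge
    have he : P \ A = ∅ := by rw [hAI]; exact Finset.sdiff_eq_empty_iff_subset.2 hPI
    rw [he] at hcardR
    simp only [Finset.sum_empty, Nat.cast_zero] at hcardR
    nlinarith
  rw [min_eq_right hle] at hAcard
  have hn : (k : ℝ) * r * (φ + 1) ≤ A.card * ε := by
    rw [hAcard, ← div_le_iff₀ hε0]
    exact Nat.le_ceil _
  have hk' : (1:ℝ) ≤ k := by exact_mod_cast hk
  have hr' : (1:ℝ) ≤ r := by exact_mod_cast hr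
  have hkr : (0:ℝ) < (k:ℝ) * r := by positivity
  have hnpos : (0:ℝ) < A.card := by
    have h0 : (0:ℝ) < (k : ℝ) * r * (φ + 1) := by positivity
    exact pos_of_mul_pos_left (h0.trans_le hn) hε0.le
  -- double counting
  have hdc : ∑ i ∈ A, (S i).card ≤ (cov S I).card * r := by
    have h1 : ∀ i ∈ A, (S i).card = ((cov S I).filter fun x => x ∈ S i).card := by
      intro i hi
      congr 1
      ext x
      simp only [cov, Finset.mem_filter, Finset.mem_biUnion]
      exact ⟨fun h => ⟨⟨i, hA hi, h⟩, h⟩, fun h => h.2⟩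
    rw [Finset.sum_congr rfl h1]
    have h2 := Finset.sum_card_bipartiteAbove_eq_sum_card_bipartiteBelow
      (s := A) (t := cov S I) (fun i x => x ∈ S i)
    unfold Finset.bipartiteAbove Finset.bipartiteBelow at h2
    rw [h2, ← smul_eq_mul]
    apply Finset.sum_le_card_nsmul
    intro x _
    exact (Finset.card_le_card (Finset.filter_subset_filter _ hA)).trans (hfreq x)
  have hdcR : ((∑ i ∈ A, (S i).card : ℕ) : ℝ) ≤ φ * (uniqCov S P).card * r := by
    obtain ⟨Q, hQI, hQk, hQ⟩ := hratio I subset_rfl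
    have h1 := mul_le_mul_of_nonneg_left (hmax Q hQI hQk) hφ.le
    have h2 : ((∑ i ∈ A, (S i).card : ℕ) : ℝ) ≤ (cov S I).card * r := by exact_mod_cast hdc
    refine h2.trans (mul_le_mul_of_nonneg_right (by linarith) (by linarith))
  have hsmall : ∀ j ∈ P \ A, A.card * (S j).card ≤ ∑ i ∈ A, (S i).card := by
    intro j hj
    rw [← smul_eq_mul]
    apply Finset.card_nsmul_le_sum
    intro i hi
    exact hAtop i hi j (Finset.sdiff_subset_sdiff hPI subset_rfl hj)
  have hsum : A.card * ∑ j ∈ P \ A, (S j).card ≤ k * ∑ i ∈ A, (S i).card := by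
    rw [Finset.mul_sum]
    refine (Finset.sum_le_card_nsmul _ _ _ hsmall).trans ?_
    rw [smul_eq_mul]
    exact Nat.mul_le_mul_right _ ((Finset.card_le_card Finset.sdiff_subset).trans hPk)
  have hsumR : (A.card : ℝ) * ((∑ j ∈ P \ A, (S j).card : ℕ) : ℝ)
      ≤ k * ((∑ i ∈ A, (S i).card : ℕ) : ℝ) := by exact_mod_cast hsum
  have hfin : ((∑ j ∈ P \ A, (S j).card : ℕ) : ℝ) ≤ ε * (uniqCov S P).card := by
    refine le_of_mul_le_mul_left ?_ hnpos
    have h1 := mul_le_mul_of_nonneg_left hdcR (by linarith : (0:ℝ) ≤ k)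
    have h2 := mul_le_mul_of_nonneg_right hn hO
    have h3 := mul_nonneg hkr.le hO
    nlinarith
  linarith
end

section
/- Let (S_i)_{i∈I} be a finite indexed family of finite sets with |I| = ℓ ≥ 2. Suppose |Ũ(I)| < |ψ(I)| / H_ℓ, and let j ∈ I satisfy |S_j ∩ Ũ(I)| ≤ |S_i ∩ Ũ(I)| for all i ∈ I. Then |ψ(I \ {j})| ≥ (1 − 1/(ℓ·H_ℓ)) · |ψ(I)|. -/
open Finset

/-- If ℓ = |I| ≥ 2, |Ũ(I)| < |ψ(I)|/H_ℓ, and j ∈ I has the smallest contribution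
|S j ∩ Ũ(I)| to the unique cover, then |ψ(I \ {j})| ≥ (1 − 1/(ℓ·H_ℓ)) · |ψ(I)|. -/
theorem stmt_8 {α ι : Type*} [DecidableEq α] [DecidableEq ι]
    (I : Finset ι) (S : ι → Finset α) (hI : 2 ≤ I.card)
    (hU : ((uniqCov S I).card : ℝ) < ((cov S I).card : ℝ) / ((harmonic I.card : ℚ) : ℝ))
    (j : ι) (hj : j ∈ I)
    (hmin : ∀ i ∈ I, (S j ∩ uniqCov S I).card ≤ (S i ∩ uniqCov S I).card) :
    ((cov S (I.erase j)).card : ℝ) ≥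
      (1 - 1 / ((I.card : ℝ) * ((harmonic I.card : ℚ) : ℝ))) * ((cov S I).card : ℝ) := by
  have h1 : I.card * (S j ∩ uniqCov S I).card ≤ (uniqCov S I).card := by
    calc I.card * (S j ∩ uniqCov S I).card = ∑ i ∈ I, (S j ∩ uniqCov S I).card := by simp
      _ ≤ ∑ i ∈ I, (S i ∩ uniqCov S I).card := Finset.sum_le_sum hmin
      _ = ∑ i ∈ I, ∑ x ∈ uniqCov S I, if x ∈ S i then 1 else 0 := by
        refine Finset.sum_congr rfl fun i _ => ?_
        rw [← Finset.card_filter, Finset.inter_comm, Finset.filter_mem_eq_inter]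
      _ = ∑ x ∈ uniqCov S I, ∑ i ∈ I, if x ∈ S i then 1 else 0 := Finset.sum_comm
      _ = ∑ x ∈ uniqCov S I, 1 := by
        refine Finset.sum_congr rfl fun x hx => ?_
        rw [← Finset.card_filter]
        exact (Finset.mem_filter.1 hx).2
      _ = (uniqCov S I).card := by simp
  have h2 : (cov S I).card ≤ (cov S (I.erase j)).card + (S j ∩ uniqCov S I).card := by
    refine le_trans (Finset.card_le_card ?_) (Finset.card_union_le _ _)
    intro x hx
    by_cases hc : x ∈ cov S (I.erase j)
    · exact Finset.mem_union_left _ hc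
    · refine Finset.mem_union_right _ ?_
      have hn : ∀ i ∈ I, x ∈ S i → i = j := by
        intro i hi hxi
        by_contra hne
        exact hc (Finset.mem_biUnion.2 ⟨i, Finset.mem_erase.2 ⟨hne, hi⟩, hxi⟩)
      obtain ⟨i, hi, hxi⟩ := Finset.mem_biUnion.1 hx
      have hxj : x ∈ S j := by
        have := hn i hi hxi
        rwa [this] at hxi
      refine Finset.mem_inter.2 ⟨hxj, Finset.mem_filter.2 ⟨hx, ?_⟩⟩
      rw [Finset.card_eq_one]
      refine ⟨j, ?_⟩
      ext k
      simp only [Finset.mem_filter, Finset.mem_singleton]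
      constructor
      · rintro ⟨hk, hxk⟩
        exact hn k hk hxk
      · rintro rfl
        exact ⟨hj, hxj⟩
  have h1' : (I.card : ℝ) * ((S j ∩ uniqCov S I).card : ℝ) ≤ ((uniqCov S I).card : ℝ) := by
    exact_mod_cast h1
  have h2' : ((cov S I).card : ℝ) ≤
      ((cov S (I.erase j)).card : ℝ) + ((S j ∩ uniqCov S I).card : ℝ) := by
    exact_mod_cast h2
  have hl : (0 : ℝ) < (I.card : ℝ) := by
    have : 0 < I.card := by omega
    exact_mod_cast this
  have h3 : ((S j ∩ uniqCov S I).card : ℝ) ≤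
      ((cov S I).card : ℝ) / ((harmonic I.card : ℚ) : ℝ) / (I.card : ℝ) := by
    rw [le_div_iff₀ hl]
    linarith
  have h4 : 1 / ((I.card : ℝ) * ((harmonic I.card : ℚ) : ℝ)) * ((cov S I).card : ℝ) =
      ((cov S I).card : ℝ) / ((harmonic I.card : ℚ) : ℝ) / (I.card : ℝ) := by
    rw [div_div, one_div, div_eq_mul_inv, mul_comm, mul_comm (I.card : ℝ)]
  have h5 : (1 - 1 / ((I.card : ℝ) * ((harmonic I.card : ℚ) : ℝ))) * ((cov S I).card : ℝ) =
      ((cov S I).card : ℝ) -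
      1 / ((I.card : ℝ) * ((harmonic I.card : ℚ) : ℝ)) * ((cov S I).card : ℝ) := by ring
  rw [h5, h4]
  linarith
end

section
/- Let (S_i)_{i∈I} be a finite indexed family of finite sets with maximum frequency at most r, where r ≥ 1 is an integer. Fix s ∈ I, and let G_1, …, G_g be pairwise disjoint subsets of I \ {s}. Then ∑_{j=1}^{g} |Ũ(G_j) ∩ S_s| ≤ (r−1)·|S_s|. -/
open Finset

/-- With max frequency at most r (r ≥ 1), s ∈ I, and pairwise disjoint
G_1, …, G_g ⊆ I \ {s}, we have ∑_j |Ũ(G_j) ∩ S s| ≤ (r−1)·|S s|. -/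
theorem stmt_10 {α ι : Type*} [DecidableEq α] [DecidableEq ι]
    (I : Finset ι) (S : ι → Finset α) (r : ℕ) (hr : 1 ≤ r)
    (hfreq : ∀ x, (I.filter fun i => x ∈ S i).card ≤ r)
    (s : ι) (hs : s ∈ I) (g : ℕ) (G : Fin g → Finset ι)
    (hGsub : ∀ j, G j ⊆ I.erase s)
    (hGdisj : ∀ j j' : Fin g, j ≠ j' → Disjoint (G j) (G j')) :
    ∑ j : Fin g, (uniqCov S (G j) ∩ S s).card ≤ (r - 1) * (S s).card := by
  have h1 : ∀ j, (uniqCov S (G j) ∩ S s).card ≤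
      ∑ x ∈ S s, ((G j).filter fun i => x ∈ S i).card := by
    intro j
    have h2 : (uniqCov S (G j) ∩ S s).card = ∑ x ∈ uniqCov S (G j) ∩ S s, 1 := by simp
    rw [h2]
    calc ∑ x ∈ uniqCov S (G j) ∩ S s, 1
        ≤ ∑ x ∈ uniqCov S (G j) ∩ S s, ((G j).filter fun i => x ∈ S i).card := by
          apply Finset.sum_le_sum
          intro x hx
          have hx' := (Finset.mem_filter.mp (Finset.mem_inter.mp hx).1).2
          exact hx'.ge
      _ ≤ _ := Finset.sum_le_sum_of_subset Finset.inter_subset_right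
  refine (Finset.sum_le_sum fun j _ => h1 j).trans ?_
  rw [Finset.sum_comm, mul_comm]
  apply Finset.sum_le_card_nsmul
  intro x hx
  have h3 : ∑ j : Fin g, ((G j).filter fun i => x ∈ S i).card =
      (Finset.univ.biUnion fun j => (G j).filter fun i => x ∈ S i).card := by
    rw [Finset.card_biUnion]
    intro j _ j' _ hne
    exact Finset.disjoint_filter_filter (hGdisj j j' hne)
  rw [h3]
  have hmem : s ∈ I.filter fun i => x ∈ S i := Finset.mem_filter.mpr ⟨hs, hx⟩
  have h4 : (Finset.univ.biUnion fun j => (G j).filter fun i => x ∈ S i) ⊆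
      (I.filter fun i => x ∈ S i).erase s := by
    intro i hi
    simp only [Finset.mem_biUnion, Finset.mem_filter, Finset.mem_univ, true_and] at hi
    obtain ⟨j, hj, hxi⟩ := hi
    have := Finset.mem_erase.mp (hGsub j hj)
    exact Finset.mem_erase.mpr ⟨this.1, Finset.mem_filter.mpr ⟨this.2, hxi⟩⟩
  have h5 := Finset.card_le_card h4
  rw [Finset.card_erase_of_mem hmem] at h5
  have := hfreq x
  omega
end

section
/- Let S_1, …, S_n be finite sets (a family indexed by {1, …, n}). Then |ψ_{≥2}({1,…,n})| = ∑_{t=1}^{n} |Ũ({1,…,t−1}) ∩ S_t|, where {1,…,0} denotes the empty index set. -/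
open Finset

theorem mem_uniqCov_aux {α : Type*} [DecidableEq α] (S : ℕ → Finset α) (J : Finset ℕ) (x : α) :
    x ∈ uniqCov S J ↔ (J.filter fun i => x ∈ S i).card = 1 := by
  unfold uniqCov
  rw [Finset.mem_filter, and_iff_right_iff_imp]
  intro h
  obtain ⟨i, hi⟩ := Finset.card_pos.mp (by omega : 0 < (J.filter fun i => x ∈ S i).card)
  rw [Finset.mem_filter] at hi
  exact Finset.mem_biUnion.mpr ⟨i, hi⟩

theorem mem_nonUniqCov_aux {α : Type*} [DecidableEq α] (S : ℕ → Finset α) (J : Finset ℕ) (x : α) :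
    x ∈ nonUniqCov S J ↔ 2 ≤ (J.filter fun i => x ∈ S i).card := by
  unfold nonUniqCov
  rw [Finset.mem_filter, and_iff_right_iff_imp]
  intro h
  obtain ⟨i, hi⟩ := Finset.card_pos.mp (by omega : 0 < (J.filter fun i => x ∈ S i).card)
  rw [Finset.mem_filter] at hi
  exact Finset.mem_biUnion.mpr ⟨i, hi⟩

/-- For sets S_1, …, S_n, |ψ_{≥2}({1,…,n})| = ∑_{t=1}^{n} |Ũ({1,…,t−1}) ∩ S_t|,
where {1,…,0} is the empty index set. -/
theorem stmt_11 {α : Type*} [DecidableEq α] (n : ℕ) (S : ℕ → Finset α) :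
    (nonUniqCov S (Finset.Icc 1 n)).card =
      ∑ t ∈ Finset.Icc 1 n, (uniqCov S (Finset.Icc 1 (t - 1)) ∩ S t).card := by
  induction n with
  | zero => simp [nonUniqCov]
  | succ n ih =>
    rw [Finset.sum_Icc_succ_top (by omega), ← ih, Nat.add_sub_cancel,
      ← Finset.card_union_of_disjoint]
    · congr 1
      ext x
      rw [Finset.mem_union, Finset.mem_inter, mem_uniqCov_aux, mem_nonUniqCov_aux,
        mem_nonUniqCov_aux, ← Finset.insert_Icc_right_eq_Icc_add_one (by omega : 1 ≤ n + 1),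
        Finset.filter_insert]
      split_ifs with h
      · rw [Finset.card_insert_of_notMem (by simp)]
        simp only [h, and_true]
        omega
      · simp [h]
    · rw [Finset.disjoint_left]
      intro x hx hy
      rw [Finset.mem_inter, mem_uniqCov_aux] at hy
      rw [mem_nonUniqCov_aux] at hx
      omega
end

section
/- Let (S_i)_{i∈I} be a finite indexed family of finite sets and let J₁, J₂ ⊆ I be disjoint. Then |Ũ(J₁ ∪ J₂)| ≥ |Ũ(J₁)| + |Ũ(J₂)| − |Ũ(J₁) ∩ ψ(J₂)| − |ψ(J₁) ∩ Ũ(J₂)|. -/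
open Finset

/-- For disjoint J₁, J₂ ⊆ I,
|Ũ(J₁ ∪ J₂)| ≥ |Ũ(J₁)| + |Ũ(J₂)| − |Ũ(J₁) ∩ ψ(J₂)| − |ψ(J₁) ∩ Ũ(J₂)|. -/
theorem stmt_14 {α ι : Type*} [DecidableEq α] [DecidableEq ι]
    (I : Finset ι) (S : ι → Finset α) (J₁ J₂ : Finset ι)
    (h₁ : J₁ ⊆ I) (h₂ : J₂ ⊆ I) (hdisj : Disjoint J₁ J₂) :
    ((uniqCov S (J₁ ∪ J₂)).card : ℤ) ≥
      ((uniqCov S J₁).card : ℤ) + ((uniqCov S J₂).card : ℤ)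
        - ((uniqCov S J₁ ∩ cov S J₂).card : ℤ) - ((cov S J₁ ∩ uniqCov S J₂).card : ℤ) := by
  have key : ∀ (A B : Finset ι), Disjoint A B → ∀ x, x ∈ uniqCov S A \ cov S B →
      x ∈ uniqCov S (A ∪ B) := by
    intro A B _ x hx
    simp only [uniqCov, cov, mem_sdiff, mem_filter, mem_biUnion] at hx ⊢
    obtain ⟨⟨⟨i, hi, hxi⟩, hc⟩, hB⟩ := hx
    refine ⟨⟨i, mem_union_left _ hi, hxi⟩, ?_⟩
    have h0 : B.filter (fun i => x ∈ S i) = ∅ := by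
      apply filter_eq_empty_iff.mpr
      intro j hj hxj
      exact hB ⟨j, hj, hxj⟩
    rw [filter_union, h0, union_empty, hc]
  have hd : Disjoint (uniqCov S J₁ \ cov S J₂) (uniqCov S J₂ \ cov S J₁) := by
    rw [Finset.disjoint_left]
    intro x hx hy
    rw [mem_sdiff] at hx hy
    exact hy.2 (mem_filter.mp hx.1).1
  have hsub : (uniqCov S J₁ \ cov S J₂) ∪ (uniqCov S J₂ \ cov S J₁) ⊆ uniqCov S (J₁ ∪ J₂) := by
    intro x hx
    rcases mem_union.mp hx with h | h
    · exact key _ _ hdisj x h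
    · rw [union_comm]
      exact key _ _ hdisj.symm x h
  have hle := card_le_card hsub
  rw [card_union_of_disjoint hd] at hle
  have e1 := card_sdiff_add_card_inter (uniqCov S J₁) (cov S J₂)
  have e2 := card_sdiff_add_card_inter (uniqCov S J₂) (cov S J₁)
  rw [inter_comm (cov S J₁)]
  omega
end

section
/- Let (S_i)_{i∈I} be a finite indexed family of finite sets. Then, as an inequality of integers, |Ũ(I)| ≥ ∑_{i∈I} ( |S_i| − ∑_{j∈I, j≠i} |S_i ∩ S_j| ). -/
open Finset

/-- As integers, |Ũ(I)| ≥ ∑_{i∈I} ( |S_i| − ∑_{j∈I, j≠i} |S_i ∩ S_j| ). -/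
theorem stmt_15 {α ι : Type*} [DecidableEq α] [DecidableEq ι]
    (I : Finset ι) (S : ι → Finset α) :
    ((uniqCov S I).card : ℤ) ≥
      ∑ i ∈ I, (((S i).card : ℤ) - ∑ j ∈ I.erase i, ((S i ∩ S j).card : ℤ)) := by
  have key : ∀ i ∈ I, ((S i).card : ℤ) - ∑ j ∈ I.erase i, ((S i ∩ S j).card : ℤ)
      ≤ ((S i ∩ uniqCov S I).card : ℤ) := by
    intro i hi
    have hsub : S i ⊆ (S i ∩ uniqCov S I) ∪ (I.erase i).biUnion (fun j => S i ∩ S j) := by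
      intro x hx
      by_cases h : ∃ j ∈ I.erase i, x ∈ S j
      · obtain ⟨j, hj, hxj⟩ := h
        exact mem_union_right _ (mem_biUnion.2 ⟨j, hj, mem_inter.2 ⟨hx, hxj⟩⟩)
      · refine mem_union_left _ (mem_inter.2 ⟨hx, mem_filter.2 ⟨mem_biUnion.2 ⟨i, hi, hx⟩, ?_⟩⟩)
        rw [card_eq_one]
        refine ⟨i, ?_⟩
        ext j
        simp only [mem_filter, mem_singleton]
        constructor
        · rintro ⟨hj, hxj⟩
          by_contra hne
          exact h ⟨j, mem_erase.2 ⟨hne, hj⟩, hxj⟩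
        · rintro rfl
          exact ⟨hi, hx⟩
    have h1 := (card_le_card hsub).trans (card_union_le _ _)
    have h2 := card_biUnion_le (s := I.erase i) (t := fun j => S i ∩ S j)
    have h3 : (S i).card ≤ (S i ∩ uniqCov S I).card + ∑ j ∈ I.erase i, (S i ∩ S j).card := by
      omega
    have h4 : ((S i).card : ℤ) ≤ (S i ∩ uniqCov S I).card
        + ∑ j ∈ I.erase i, ((S i ∩ S j).card : ℤ) := by exact_mod_cast h3
    linarith
  refine (sum_le_sum key).trans ?_
  have hd : (I.biUnion fun i => S i ∩ uniqCov S I).card = ∑ i ∈ I, (S i ∩ uniqCov S I).card := by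
    apply card_biUnion
    intro i hi j hj hij
    rw [Function.onFun, disjoint_left]
    intro x hx hx2
    rw [mem_inter] at hx hx2
    have hc := (mem_filter.1 hx.2).2
    exact hij (card_le_one.1 hc.le i (mem_filter.2 ⟨hi, hx.1⟩) j (mem_filter.2 ⟨hj, hx2.1⟩))
  have hs : (I.biUnion fun i => S i ∩ uniqCov S I) ⊆ uniqCov S I :=
    biUnion_subset.2 fun i _ => inter_subset_right
  have := card_le_card hs
  rw [hd] at this
  exact_mod_cast this
end

section
/- Let (S_i)_{i∈A} be a finite indexed family of finite sets with maximum frequency at most r (r ≥ 1 an integer), let ℓ be an integer with 1 ≤ ℓ ≤ |A|, set p = ℓ/|A|, and let ε ∈ (0,1) satisfy p·r ≤ ε. Then the average of |Ũ(Z)| over all ℓ-element subsets Z ⊆ A is at least p(1−ε) · ∑_{i∈A}|S_i|; equivalently, ∑_{Z ⊆ A, |Z| = ℓ} |Ũ(Z)| ≥ C(|A|, ℓ) · p(1−ε) · ∑_{i∈A}|S_i|, where C(·,·) is the binomial coefficient. -/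
open Finset

lemma cnt_sup {ι : Type*} [DecidableEq ι] (A T : Finset ι) (hT : T ⊆ A) (l : ℕ)
    (hl : T.card ≤ l) :
    ((A.powersetCard l).filter fun Z => T ⊆ Z).card
      = (A.card - T.card).choose (l - T.card) := by
  rw [← card_sdiff_of_subset hT, ← card_powersetCard]
  refine card_bij' (fun Z _ => Z \ T) (fun W _ => W ∪ T) ?_ ?_ ?_ ?_
  · intro Z hZ
    simp only [mem_filter, mem_powersetCard] at hZ ⊢
    exact ⟨sdiff_subset_sdiff hZ.1.1 (le_refl T), by rw [card_sdiff_of_subset hZ.2, hZ.1.2]⟩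
  · intro W hW
    simp only [mem_filter, mem_powersetCard] at hW ⊢
    have hd : Disjoint W T := disjoint_of_subset_left hW.1 sdiff_disjoint
    refine ⟨⟨union_subset (hW.1.trans sdiff_subset) hT, ?_⟩, subset_union_right⟩
    rw [card_union_of_disjoint hd]; omega
  · intro Z hZ
    simp only [mem_filter] at hZ
    exact sdiff_union_of_subset hZ.2
  · intro W hW
    simp only [mem_powersetCard] at hW
    have hd : Disjoint W T := disjoint_of_subset_left hW.1 sdiff_disjoint
    exact union_sdiff_cancel_right hd

lemma cnt_one {ι : Type*} [DecidableEq ι] (A : Finset ι) (i : ι) (hi : i ∈ A) (l : ℕ)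
    (hl : 1 ≤ l) :
    (((A.powersetCard l).filter fun Z => i ∈ Z).card : ℝ)
      = (A.card.choose l : ℝ) * ((l : ℝ) / A.card) := by
  have h := cnt_sup A {i} (by simpa using hi) l (by simpa using hl)
  simp only [singleton_subset_iff, card_singleton] at h
  rw [h]
  have hA : 0 < A.card := card_pos.2 ⟨i, hi⟩
  obtain ⟨n, hn⟩ : ∃ n, A.card = n + 1 := ⟨A.card - 1, by omega⟩
  obtain ⟨k, rfl⟩ : ∃ k, l = k + 1 := ⟨l - 1, by omega⟩
  rw [hn]
  have := Nat.add_one_mul_choose_eq n k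
  have h2 : ((n : ℝ) + 1) * (n.choose k) = ((n+1).choose (k+1)) * ((k : ℝ) + 1) := by
    exact_mod_cast this
  simp only [Nat.add_sub_cancel]
  push_cast
  field_simp
  linarith

lemma cnt_two {ι : Type*} [DecidableEq ι] (A : Finset ι) (i j : ι) (hi : i ∈ A) (hj : j ∈ A)
    (hij : i ≠ j) (l : ℕ) (hl : 1 ≤ l) (hlA : l ≤ A.card) :
    (((A.powersetCard l).filter fun Z => i ∈ Z ∧ j ∈ Z).card : ℝ)
      ≤ (A.card.choose l : ℝ) * ((l : ℝ) / A.card) * ((l : ℝ) / A.card) := by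
  have hc : ({i, j} : Finset ι).card = 2 := card_pair hij
  have hT : ({i, j} : Finset ι) ⊆ A := by
    intro x hx; simp only [mem_insert, mem_singleton] at hx; rcases hx with rfl | rfl <;> assumption
  have hA : 2 ≤ A.card := hc ▸ card_le_card hT
  rcases Nat.lt_or_ge l 2 with h2 | h2
  · have : ((A.powersetCard l).filter fun Z => i ∈ Z ∧ j ∈ Z) = ∅ := by
      apply filter_eq_empty_iff.2
      intro Z hZ h
      have : ({i, j} : Finset ι) ⊆ Z := by
        intro x hx; simp only [mem_insert, mem_singleton] at hx
        rcases hx with rfl | rfl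
        exacts [h.1, h.2]
      have := card_le_card this
      rw [hc, (mem_powersetCard.1 hZ).2] at this
      omega
    rw [this]; simp; positivity
  have h := cnt_sup A {i, j} hT l (by omega)
  simp only [insert_subset_iff, singleton_subset_iff, hc] at h
  rw [h]
  obtain ⟨n, hn⟩ : ∃ n, A.card = n + 2 := ⟨A.card - 2, by omega⟩
  obtain ⟨k, rfl⟩ : ∃ k, l = k + 2 := ⟨l - 2, by omega⟩
  rw [hn] at hlA ⊢
  have e1 : ((n : ℝ) + 1) * (n.choose k) = ((n+1).choose (k+1)) * ((k : ℝ) + 1) := by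
    exact_mod_cast Nat.add_one_mul_choose_eq n k
  have e2 : ((n : ℝ) + 1 + 1) * ((n+1).choose (k+1))
      = ((n+2).choose (k+2)) * ((k : ℝ) + 1 + 1) := by
    exact_mod_cast Nat.add_one_mul_choose_eq (n+1) (k+1)
  simp only [Nat.add_sub_cancel]
  have e3 : (((n+2).choose (k+2) : ℕ) : ℝ) * (((k + 2 : ℕ) : ℝ) / ((n + 2 : ℕ) : ℝ))
      = ((n+1).choose (k+1)) := by
    push_cast; field_simp; linarith
  have e4 : (n.choose k : ℝ) = ((n+1).choose (k+1)) * (((k : ℝ) + 1) / (n+1)) := by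
    field_simp; linarith
  rw [e3, e4]
  gcongr ?_ * ?_
  push_cast
  have : (k : ℝ) ≤ n := by exact_mod_cast (by omega : k ≤ n)
  rw [div_le_div_iff₀ (by positivity) (by positivity)]
  nlinarith

lemma one_pt {ι : Type*} [DecidableEq ι] (A F : Finset ι) (hF : F ⊆ A) (l : ℕ)
    (hl : 1 ≤ l) (hlA : l ≤ A.card) (r : ℕ) (hr : F.card ≤ r) (ε : ℝ)
    (hpr : (l : ℝ) / (A.card : ℝ) * (r : ℝ) ≤ ε) :
    (A.card.choose l : ℝ) * ((l : ℝ) / (A.card : ℝ)) * (1 - ε) * F.card ≤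
      ∑ Z ∈ A.powersetCard l, (if (Z ∩ F).card = 1 then (1 : ℝ) else 0) := by
  have key : ∀ Z : Finset ι, (∑ i ∈ F, (if i ∈ Z then (1 : ℝ) else 0))
      - ∑ q ∈ F.offDiag, (if q.1 ∈ Z ∧ q.2 ∈ Z then (1 : ℝ) else 0)
      ≤ (if (Z ∩ F).card = 1 then (1 : ℝ) else 0) := by
    intro Z
    have h1 : (∑ i ∈ F, (if i ∈ Z then (1 : ℝ) else 0)) = ((Z ∩ F).card : ℝ) := by
      rw [sum_boole, filter_mem_eq_inter, inter_comm]
    have h2 : ∑ q ∈ F.offDiag, (if q.1 ∈ Z ∧ q.2 ∈ Z then (1 : ℝ) else 0)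
        = (((Z ∩ F).offDiag).card : ℝ) := by
      rw [sum_boole]; congr 2; ext ⟨a, b⟩; simp only [mem_filter, mem_offDiag, mem_inter]; tauto
    rw [h1, h2, offDiag_card, Nat.cast_sub (Nat.le_mul_self _)]
    push_cast
    generalize (Z ∩ F).card = k
    rcases k with _ | _ | k
    · simp
    · simp
    · rw [if_neg (by omega)]; push_cast; nlinarith [(Nat.cast_nonneg k : (0 : ℝ) ≤ k)]
  refine le_trans ?_ (sum_le_sum fun Z _ => key Z)
  rw [sum_sub_distrib, sum_comm, sum_comm (s := A.powersetCard l) (t := F.offDiag)]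
  simp only [sum_boole]
  rw [sum_congr rfl fun i hi => cnt_one A i (hF hi) l hl]
  have hb : ∑ q ∈ F.offDiag,
      (((A.powersetCard l).filter fun Z => q.1 ∈ Z ∧ q.2 ∈ Z).card : ℝ)
      ≤ ∑ q ∈ F.offDiag, (A.card.choose l : ℝ) * ((l : ℝ) / A.card) * ((l : ℝ) / A.card) := by
    refine sum_le_sum fun q hq => ?_
    rw [mem_offDiag] at hq
    exact cnt_two A q.1 q.2 (hF hq.1) (hF hq.2.1) hq.2.2 l hl hlA
  refine le_trans ?_ (sub_le_sub_left hb _)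
  simp only [sum_const, nsmul_eq_mul]
  rw [offDiag_card, Nat.cast_sub (Nat.le_mul_self _)]
  push_cast
  have hp : (0 : ℝ) ≤ (l : ℝ) / A.card := by positivity
  have hC : (0 : ℝ) ≤ (A.card.choose l : ℝ) * ((l : ℝ) / A.card) := by positivity
  generalize (A.card.choose l : ℝ) * ((l : ℝ) / A.card) = C at *
  generalize (l : ℝ) / A.card = p at *
  have hf : (F.card : ℝ) ≤ r := by exact_mod_cast hr
  have hf0 : (0 : ℝ) ≤ F.card := by positivity
  generalize (F.card : ℝ) = f at *
  have h1 : (f - 1) * p ≤ ε := by nlinarith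
  have h2 : C * f * ((f - 1) * p) ≤ C * f * ε := mul_le_mul_of_nonneg_left h1 (by positivity)
  linarith

/-- With max frequency at most r (r ≥ 1), 1 ≤ ℓ ≤ |A|, p = ℓ/|A|, and
ε ∈ (0,1) with p·r ≤ ε, the sum of |Ũ(Z)| over all ℓ-element subsets Z ⊆ A is at least
C(|A|,ℓ) · p(1−ε) · ∑_{i∈A}|S_i|. -/
theorem stmt_16 {α ι : Type*} [DecidableEq α] [DecidableEq ι]
    (A : Finset ι) (S : ι → Finset α) (r : ℕ) (hr : 1 ≤ r)
    (hfreq : ∀ x, (A.filter fun i => x ∈ S i).card ≤ r)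
    (ℓ : ℕ) (hℓ : 1 ≤ ℓ) (hℓA : ℓ ≤ A.card)
    (ε : ℝ) (hε : ε ∈ Set.Ioo (0 : ℝ) 1)
    (hpr : (ℓ : ℝ) / (A.card : ℝ) * (r : ℝ) ≤ ε) :
    ∑ Z ∈ A.powersetCard ℓ, ((uniqCov S Z).card : ℝ) ≥
      (A.card.choose ℓ : ℝ) * ((ℓ : ℝ) / (A.card : ℝ)) * (1 - ε) *
        ∑ i ∈ A, ((S i).card : ℝ) := by
  set U := A.biUnion S with hU
  have hS : ∀ i ∈ A, ((S i).card : ℝ) = ∑ x ∈ U, (if x ∈ S i then (1 : ℝ) else 0) := by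
    intro i hi
    rw [sum_boole]; congr 2; ext x
    simp only [mem_filter, hU, mem_biUnion]
    exact ⟨fun h => ⟨⟨i, hi, h⟩, h⟩, fun h => h.2⟩
  have hZ : ∀ Z ∈ A.powersetCard ℓ, ((uniqCov S Z).card : ℝ)
      = ∑ x ∈ U, (if (Z ∩ A.filter fun i => x ∈ S i).card = 1 then (1 : ℝ) else 0) := by
    intro Z hZ
    have hZA := (mem_powersetCard.1 hZ).1
    have e : ∀ x, (Z ∩ A.filter fun i => x ∈ S i) = Z.filter fun i => x ∈ S i := by
      intro x; ext i; simp only [mem_inter, mem_filter]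
      exact ⟨fun h => ⟨h.1, h.2.2⟩, fun h => ⟨h.1, hZA h.1, h.2⟩⟩
    simp only [e]
    rw [sum_boole]; congr 2; ext x
    simp only [uniqCov, mem_filter, hU, mem_biUnion]
    constructor
    · rintro ⟨⟨i, hi, hx⟩, h⟩
      exact ⟨⟨i, hZA hi, hx⟩, h⟩
    · rintro ⟨_, h⟩
      obtain ⟨i, hi⟩ := card_pos.1 (by omega : 0 < (Z.filter fun i => x ∈ S i).card)
      exact ⟨⟨i, (mem_filter.1 hi).1, (mem_filter.1 hi).2⟩, h⟩
  rw [sum_congr rfl hZ, sum_congr rfl hS, sum_comm, sum_comm (s := A), mul_sum]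
  refine sum_le_sum fun x _ => ?_
  rw [sum_boole]
  exact one_pt A _ (filter_subset _ _) ℓ hℓ hℓA r (hfreq x) ε hpr
end
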